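/- Let g ≥ 2 and let d ≥ 2 be an even integer. Then Γ_g[d², 2d²] = [Γ_g[d], Γ_g[d]], i.e. the subgroup of Γ_g[d²] consisting of matrices whose q- and r-blocks have even diagonal entries equals the commutator subgroup of Γ_g[d]. -/

import Mathlib

open Matrix

/-- The index type for `2g × 2g` matrices, written as `Fin g ⊕ Fin g`. -/
abbrev Idx (g : ℕ) := Fin g ⊕ Fin g

/-- The integral symplectic group `Sp(2g; ℤ)`. -/
abbrev SpZ (g : ℕ) := Matrix.symplecticGroup (Fin g) ℤ

/-- Entrywise reduction of integral matrices mod `d`. -/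
def modred (g d : ℕ) : Matrix (Idx g) (Idx g) ℤ →+* Matrix (Idx g) (Idx g) (ZMod d) :=
  (Int.castRingHom (ZMod d)).mapMatrix

/-- The level `d` congruence subgroup `Γ_g[d]` of `Sp(2g; ℤ)`:
matrices congruent to the identity mod `d`. -/
def Gamma (g d : ℕ) : Subgroup ↥(SpZ g) where
  carrier := {A | modred g d (A : Matrix (Idx g) (Idx g) ℤ) = 1}
  one_mem' := by
    simp [Set.mem_setOf_eq]
  mul_mem' := by
    intro a b ha hb
    simp only [Set.mem_setOf_eq, Submonoid.coe_mul, _root_.map_mul] at *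
    rw [ha, hb, one_mul]
  inv_mem' := by
    intro a ha
    simp only [Set.mem_setOf_eq] at *
    have h : modred g d ((a⁻¹ : ↥(SpZ g)) : Matrix (Idx g) (Idx g) ℤ) *
        modred g d ((a : ↥(SpZ g)) : Matrix (Idx g) (Idx g) ℤ) = 1 := by
      rw [← _root_.map_mul, ← Submonoid.coe_mul, inv_mul_cancel, Submonoid.coe_one, _root_.map_one]
    calc modred g d ((a⁻¹ : ↥(SpZ g)) : Matrix (Idx g) (Idx g) ℤ)
        = modred g d ((a⁻¹ : ↥(SpZ g)) : Matrix (Idx g) (Idx g) ℤ) *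
            modred g d ((a : ↥(SpZ g)) : Matrix (Idx g) (Idx g) ℤ) := by rw [ha, mul_one]
      _ = 1 := h

lemma mem_Gamma_iff {g d : ℕ} {A : ↥(SpZ g)} :
    A ∈ Gamma g d ↔ ∀ i j : Idx g, (d : ℤ) ∣
      ((A : Matrix (Idx g) (Idx g) ℤ) i j - (1 : Matrix (Idx g) (Idx g) ℤ) i j) := by
  have : A ∈ Gamma g d ↔ modred g d (A : Matrix (Idx g) (Idx g) ℤ) = 1 := Iff.rfl
  rw [this, ← Matrix.ext_iff]
  constructor
  · intro h i j
    have hij := h i j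
    simp only [modred, RingHom.mapMatrix_apply, Matrix.map_apply, Int.coe_castRingHom] at hij
    have h1 : ((1 : Matrix (Idx g) (Idx g) ℤ) i j : ZMod d) = (1 : Matrix (Idx g) (Idx g) (ZMod d)) i j := by
      by_cases hij' : i = j <;> simp [Matrix.one_apply, hij']
    rw [← h1] at hij
    rw [← ZMod.intCast_zmod_eq_zero_iff_dvd]
    push_cast
    rw [hij]
    ring
  · intro h i j
    have hij := h i j
    rw [← ZMod.intCast_zmod_eq_zero_iff_dvd] at hij
    push_cast at hij
    simp only [modred, RingHom.mapMatrix_apply, Matrix.map_apply, Int.coe_castRingHom]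
    have h1 : ((1 : Matrix (Idx g) (Idx g) ℤ) i j : ZMod d) = (1 : Matrix (Idx g) (Idx g) (ZMod d)) i j := by
      by_cases hij' : i = j <;> simp [Matrix.one_apply, hij']
    rw [← h1]
    linear_combination hij
lemma Gamma_entry_dvd {g d : ℕ} {A : ↥(SpZ g)} (hA : A ∈ Gamma g d) {i j : Idx g}
    (hij : i ≠ j) : (d : ℤ) ∣ (A : Matrix (Idx g) (Idx g) ℤ) i j := by
  have := mem_Gamma_iff.mp hA i j
  rwa [Matrix.one_apply_ne hij, sub_zero] at this

lemma Gamma_one_sub_dvd {g d : ℕ} {A : ↥(SpZ g)} (hA : A ∈ Gamma g d) (i j : Idx g) :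
    (d : ℤ) ∣ ((1 : Matrix (Idx g) (Idx g) ℤ) - (A : Matrix (Idx g) (Idx g) ℤ)) i j := by
  have h := mem_Gamma_iff.mp hA i j
  have he : ((1 : Matrix (Idx g) (Idx g) ℤ) - (A : Matrix (Idx g) (Idx g) ℤ)) i j
      = -((A : Matrix (Idx g) (Idx g) ℤ) i j - (1 : Matrix (Idx g) (Idx g) ℤ) i j) := by
    rw [Matrix.sub_apply]; ring
  rw [he]
  exact dvd_neg.mpr h

lemma two_d_dvd_d_mul_d {d : ℕ} (hd : Even d) : (2 * d : ℤ) ∣ (d : ℤ) * (d : ℤ) := by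
  obtain ⟨e, he⟩ := hd
  refine ⟨(e : ℤ), ?_⟩
  push_cast [he]
  ring

/-- The subgroup `Γ_g[d, 2d]` (for even `d`) of `Γ_g[d]`: matrices `A = I + dA'` such that
the diagonal entries of the upper-right and lower-left `g×g` blocks of `A'` are even,
i.e. the `(inl i, inr i)` and `(inr i, inl i)` entries of `A` are divisible by `2d`. -/
def GammaMod (g : ℕ) (d : ℕ) (hd : Even d) : Subgroup ↥(SpZ g) where
  carrier := {A | A ∈ Gamma g d ∧ ∀ i : Fin g,
    (2 * d : ℤ) ∣ (A : Matrix (Idx g) (Idx g) ℤ) (Sum.inl i) (Sum.inr i) ∧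
    (2 * d : ℤ) ∣ (A : Matrix (Idx g) (Idx g) ℤ) (Sum.inr i) (Sum.inl i)}
  one_mem' := by
    refine ⟨one_mem _, fun i => ?_⟩
    constructor <;> simp [Matrix.one_apply]
  mul_mem' := by
    rintro a b ⟨ha1, ha2⟩ ⟨hb1, hb2⟩
    refine ⟨mul_mem ha1 hb1, fun i => ?_⟩
    constructor
    · rw [Submonoid.coe_mul, Matrix.mul_apply]
      refine Finset.dvd_sum fun k _ => ?_
      rcases k with k | k
      · by_cases hk : k = i
        · subst hk
          exact Dvd.dvd.mul_left (hb2 k).1 _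
        · refine dvd_trans (two_d_dvd_d_mul_d hd) (mul_dvd_mul ?_ ?_)
          · exact Gamma_entry_dvd ha1 (by simp only [ne_eq, Sum.inl.injEq, Sum.inr.injEq]; first | exact fun h => hk h | exact fun h => hk h.symm)
          · exact Gamma_entry_dvd hb1 (by simp)
      · by_cases hk : k = i
        · subst hk
          exact Dvd.dvd.mul_right (ha2 k).1 _
        · refine dvd_trans (two_d_dvd_d_mul_d hd) (mul_dvd_mul ?_ ?_)
          · exact Gamma_entry_dvd ha1 (by simp)
          · exact Gamma_entry_dvd hb1 (by simp only [ne_eq, Sum.inl.injEq, Sum.inr.injEq]; first | exact fun h => hk h | exact fun h => hk h.symm)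
    · rw [Submonoid.coe_mul, Matrix.mul_apply]
      refine Finset.dvd_sum fun k _ => ?_
      rcases k with k | k
      · by_cases hk : k = i
        · subst hk
          exact Dvd.dvd.mul_right (ha2 k).2 _
        · refine dvd_trans (two_d_dvd_d_mul_d hd) (mul_dvd_mul ?_ ?_)
          · exact Gamma_entry_dvd ha1 (by simp)
          · exact Gamma_entry_dvd hb1 (by simp only [ne_eq, Sum.inl.injEq, Sum.inr.injEq]; first | exact fun h => hk h | exact fun h => hk h.symm)
      · by_cases hk : k = i
        · subst hk
          exact Dvd.dvd.mul_left (hb2 k).2 _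
        · refine dvd_trans (two_d_dvd_d_mul_d hd) (mul_dvd_mul ?_ ?_)
          · exact Gamma_entry_dvd ha1 (by simp only [ne_eq, Sum.inl.injEq, Sum.inr.injEq]; first | exact fun h => hk h | exact fun h => hk h.symm)
          · exact Gamma_entry_dvd hb1 (by simp)
  inv_mem' := by
    rintro a ⟨ha1, ha2⟩
    refine ⟨inv_mem ha1, fun i => ?_⟩
    have hAA : ((a : ↥(SpZ g)) : Matrix (Idx g) (Idx g) ℤ) *
        ((a⁻¹ : ↥(SpZ g)) : Matrix (Idx g) (Idx g) ℤ) = 1 := by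
      rw [← Submonoid.coe_mul, mul_inv_cancel, Submonoid.coe_one]
    have hAA' : ((a⁻¹ : ↥(SpZ g)) : Matrix (Idx g) (Idx g) ℤ) *
        ((a : ↥(SpZ g)) : Matrix (Idx g) (Idx g) ℤ) = 1 := by
      rw [← Submonoid.coe_mul, inv_mul_cancel, Submonoid.coe_one]
    set X : Matrix (Idx g) (Idx g) ℤ := ((a⁻¹ : ↥(SpZ g)) : Matrix (Idx g) (Idx g) ℤ) with hX
    set A : Matrix (Idx g) (Idx g) ℤ := ((a : ↥(SpZ g)) : Matrix (Idx g) (Idx g) ℤ) with hA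
    have key : X = (2 : ℤ) • (1 : Matrix (Idx g) (Idx g) ℤ) - A + (1 - A) * X * (1 - A) := by
      have e1 : ((1 : Matrix (Idx g) (Idx g) ℤ) - A) * X = X - 1 := by
        rw [sub_mul, one_mul, hAA]
      have e2 : (X - 1) * ((1 : Matrix (Idx g) (Idx g) ℤ) - A) = X - 1 - (1 - A) := by
        rw [sub_mul, one_mul, mul_sub, mul_one, hAA']
      rw [e1, e2]
      have : (2 : ℤ) • (1 : Matrix (Idx g) (Idx g) ℤ) = 1 + 1 := by
        rw [two_smul]
      rw [this]
      abel
    have hprod : ∀ i' j' : Idx g, (2 * d : ℤ) ∣ ((1 - A) * X * (1 - A)) i' j' := by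
      intro i' j'
      rw [Matrix.mul_apply]
      refine Finset.dvd_sum fun k _ => ?_
      refine dvd_trans (two_d_dvd_d_mul_d hd) (mul_dvd_mul ?_ ?_)
      · rw [Matrix.mul_apply]
        refine Finset.dvd_sum fun l _ => ?_
        exact Dvd.dvd.mul_right (Gamma_one_sub_dvd ha1 i' l) _
      · exact Gamma_one_sub_dvd ha1 k j'
    constructor
    · rw [key]
      simp only [Matrix.add_apply, Matrix.sub_apply, Matrix.smul_apply,
        Matrix.one_apply_ne (show (Sum.inl i : Idx g) ≠ Sum.inr i by simp), smul_zero]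
      refine dvd_add (dvd_sub (Dvd.intro 0 rfl) ?_) (hprod _ _)
      exact (ha2 i).1
    · rw [key]
      simp only [Matrix.add_apply, Matrix.sub_apply, Matrix.smul_apply,
        Matrix.one_apply_ne (show (Sum.inr i : Idx g) ≠ Sum.inl i by simp), smul_zero]
      refine dvd_add (dvd_sub (Dvd.intro 0 rfl) ?_) (hprod _ _)
      exact (ha2 i).2

section SymbolArithmetic

/-- Dirichlet's theorem with an integral modulus. -/
lemma exists_prime_dvd_sub {c N : ℤ} (hN : N ≠ 0) (h : IsCoprime c N) :
    ∃ p : ℕ, p.Prime ∧ N ∣ p - c := by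
  have h' : IsCoprime c (N.natAbs : ℤ) := by
    simpa [Int.isCoprime_iff_gcd_eq_one, Int.gcd_def, Int.natAbs_abs] using h
  obtain ⟨p, -, hp, hpc⟩ := Nat.forall_exists_prime_gt_and_zmodEq 0 (Int.natAbs_ne_zero.mpr hN) h'
  exact ⟨p, hp, Int.natAbs_dvd.mp hpc.symm.dvd⟩

/-- If `a, b, c` generate the unit ideal, some `a + t * b` is prime to `c`. -/
lemma exists_isCoprime_add_mul {a b c : ℤ} (hc : c ≠ 0) (h : ∃ x y z, a * x + b * y + c * z = 1) :
    ∃ t, IsCoprime (a + t * b) c := by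
  obtain ⟨x, y, z, hxyz⟩ := h
  have : NeZero c.natAbs := ⟨Int.natAbs_ne_zero.mpr hc⟩
  have hg : Int.gcd b c ∣ c.natAbs := Int.gcd_dvd_natAbs_right b c
  have hcop : IsCoprime a (Int.gcd b c : ℤ) := by
    obtain ⟨b', hb'⟩ := Int.gcd_dvd_left b c
    obtain ⟨c', hc'⟩ := Int.gcd_dvd_right b c
    refine ⟨x, b' * y + c' * z, ?_⟩
    linear_combination hxyz - y * hb' - z * hc'
  obtain ⟨u, hu⟩ := ZMod.unitsMap_surjective hg
    (ZMod.unitOfIsCoprime a (by exact_mod_cast hcop))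
  have hu' : ((u : ZMod c.natAbs).cast : ZMod (Int.gcd b c)) = (a : ZMod (Int.gcd b c)) := by
    have := congrArg Units.val hu
    simpa [ZMod.unitsMap_def] using this
  obtain ⟨r, hr⟩ := ZMod.intCast_surjective (u : ZMod c.natAbs)
  rw [← hr, ZMod.cast_intCast hg, ZMod.intCast_eq_intCast_iff_dvd_sub] at hu'
  obtain ⟨s, hs⟩ := hu'
  have hbez := Int.gcd_eq_gcd_ab b c
  have hrc : IsCoprime r c := by
    have : IsUnit ((r : ℤ) : ZMod c.natAbs) := hr ▸ u.isUnit
    rw [ZMod.coe_int_isUnit_iff_isCoprime] at this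
    simpa [Int.isCoprime_iff_gcd_eq_one, Int.gcd_def, Int.natAbs_abs] using this.symm
  refine ⟨-(s * Int.gcdA b c), ?_⟩
  have : a + -(s * Int.gcdA b c) * b = r + (s * Int.gcdB b c) * c := by
    linear_combination hs + s * hbez
  rw [this]
  exact (IsCoprime.add_mul_right_left hrc _)

/-- Two primes `ℓ ≡ -a mod b` with coprime values of `(ℓ - 1) / 2`. -/
lemma exists_two_primes {a b c m : ℤ} (hm : 4 ∣ m) (hm0 : m ≠ 0) (ha : m ∣ a - 1)
    (hbc : b = 1 + c * (a + 1)) (hab : IsCoprime a (m * b)) :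
    ∃ n₁ n₂ : ℕ, (2 * n₁ + 1).Prime ∧ (2 * n₂ + 1).Prime ∧ m * b ∣ (2 * n₁ + 1 : ℤ) + a ∧
      m * b ∣ (2 * n₂ + 1 : ℤ) + a ∧ Nat.Coprime n₁ n₂ := by
  obtain ⟨m', rfl⟩ := hm
  obtain ⟨k, hk⟩ := ha
  have hm'0 : m' ≠ 0 := by rintro rfl; simp at hm0
  have hb0 : b ≠ 0 := by
    rintro rfl
    have h1 : (2 : ℤ) ∣ 1 := ⟨-(c * (1 + 2 * m' * k)), by linear_combination -hbc - c * hk⟩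
    omega
  have hN0 : 4 * m' * b ≠ 0 := mul_ne_zero hm0 hb0
  have odd_of : ∀ ℓ : ℕ, ℓ.Prime → 4 * m' * b ∣ ℓ + a → ∃ n : ℕ, ℓ = 2 * n + 1 ∧ n % 2 = 1 := by
    rintro ℓ - ⟨t, ht⟩
    refine ⟨ℓ / 2, ?_⟩
    have : (ℓ : ℤ) = 4 * (m' * b * t - m' * k) - 1 := by linear_combination ht - hk
    omega
  obtain ⟨ℓ, hℓ, hℓa⟩ := exists_prime_dvd_sub hN0 hab.neg_left
  rw [sub_neg_eq_add] at hℓa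
  obtain ⟨n, rfl, hn2⟩ := odd_of ℓ hℓ hℓa
  obtain ⟨t, ht⟩ := hℓa
  push_cast at ht
  have hnb : IsCoprime (n : ℤ) b :=
    ⟨2 * c, 1 - c * t * 4 * m', by linear_combination c * ht + hbc⟩
  have hn2m : IsCoprime (n : ℤ) (2 * m') := ⟨-1, t * b - k, by linarith⟩
  have hn_two : IsCoprime (n : ℤ) 2 := hn2m.of_mul_right_left
  have hn4m : IsCoprime (n : ℤ) (4 * m') := by
    have := hn_two.mul_right hn2m
    rwa [← mul_assoc] at this
  have hnN : IsCoprime (n : ℤ) (4 * m' * b) := hn4m.mul_right hnb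
  obtain ⟨x, y, hxy⟩ := hnN
  have hn0 : (n : ℤ) ≠ 0 := by omega
  obtain ⟨p, hp, hpc⟩ := exists_prime_dvd_sub (c := -1 + x * n * (1 - a))
    (N := n * (4 * m' * b)) (mul_ne_zero hn0 hN0) (by
      refine IsCoprime.mul_right ⟨-1, x * (1 - a), by ring⟩ ?_
      have : -1 + x * n * (1 - a) = -a + (-(y * (1 - a))) * (4 * m' * b) := by
        linear_combination (1 - a) * hxy
      rw [this]
      exact IsCoprime.add_mul_right_left hab.neg_left _)
  obtain ⟨s, hs⟩ := hpc
  have hpa : 4 * m' * b ∣ p + a := ⟨n * s - y * (1 - a), by linear_combination hs + (1 - a) * hxy⟩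
  obtain ⟨q, rfl, -⟩ := odd_of p hp hpa
  refine ⟨n, q, hℓ, hp, ⟨t, ht⟩, by exact_mod_cast hpa, ?_⟩
  rw [← Nat.isCoprime_iff_coprime]
  obtain ⟨u, v, huv⟩ := hn_two
  push_cast at hs
  refine ⟨u * (1 + q) + v * (x * (1 - a) + (4 * m' * b) * s), -1, ?_⟩
  linear_combination (1 + (q : ℤ)) * huv - v * hs

variable {Q : Type*} [Group Q] {m : ℤ} {lam sig : ℤ → ℤ → Q}

lemma isCoprime_two_mul_of_dvd_sub_one {a : ℤ} (h4 : 4 ∣ m) (ha : m ∣ a - 1) :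
    IsCoprime a (2 * m) := by
  obtain ⟨k, hk⟩ := ha
  obtain ⟨m', rfl⟩ := h4
  have h1 : IsCoprime a (2 * m') := ⟨1, -(2 * k), by linear_combination hk⟩
  have h2 := h1.of_mul_right_left
  have := h2.mul_right (h2.mul_right h1)
  rwa [show 2 * (4 * m') = 2 * (2 * (2 * m')) by ring]

lemma sig_pow_mul_lam (h4 : 4 ∣ m)
    (rel : ∀ a b c, m ∣ a - 1 → m ∣ b → 2 * m ∣ c → IsCoprime a b → IsCoprime a c →
      sig a b * lam a c = lam a (b ^ 2 * c))
    {a b : ℤ} (ha : m ∣ a - 1) (hb : m ∣ b) (hab : IsCoprime a b) (n : ℕ) :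
    sig a b ^ n * lam a (2 * m) = lam a (2 * m * (b ^ (2 * n))) := by
  have ha2 := isCoprime_two_mul_of_dvd_sub_one h4 ha
  induction n with
  | zero => simp
  | succ n ih =>
    rw [pow_succ', mul_assoc, ih, rel a b _ ha hb (dvd_mul_right _ _) hab
      (ha2.mul_right hab.pow_right)]
    congr 1
    ring

/-- The symbol `sig` attached to the short roots is trivial. -/
lemma sig_eq_one (h4 : 4 ∣ m) (hm0 : m ≠ 0)
    (lam_right : ∀ a b t, m ∣ a - 1 → 2 * m ∣ b → IsCoprime a b →
      lam a (b + 2 * m * t * a) = lam a b)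
    (sig_left : ∀ a b t, m ∣ a - 1 → m ∣ b → IsCoprime a b → sig (a + t * b) b = sig a b)
    (sig_right : ∀ a b t, m ∣ a - 1 → m ∣ b → IsCoprime a b → sig a (b + m * t * a) = sig a b)
    (rel : ∀ a b c, m ∣ a - 1 → m ∣ b → 2 * m ∣ c → IsCoprime a b → IsCoprime a c →
      sig a b * lam a c = lam a (b ^ 2 * c))
    {a b : ℤ} (ha : m ∣ a - 1) (hb : m ∣ b) (hab : IsCoprime a b) : sig a b = 1 := by
  obtain ⟨b, rfl⟩ := hb
  rw [← sig_right a (m * b) (b - 1) ha (dvd_mul_right _ _) hab]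
  have hb' : m * b + m * (b - 1) * a = m * (1 + (b - 1) * (a + 1)) := by ring
  have hab' : IsCoprime a (m * (1 + (b - 1) * (a + 1))) := by
    rw [← hb']
    exact hab.add_mul_right_right _
  rw [hb']
  generalize hB : 1 + (b - 1) * (a + 1) = B at *
  obtain ⟨n₁, n₂, hp₁, hp₂, hd₁, hd₂, hcop⟩ := exists_two_primes h4 hm0 ha hB.symm hab'
  have key : ∀ n : ℕ, (2 * n + 1).Prime → m * B ∣ (2 * n + 1 : ℤ) + a → sig a (m * B) ^ n = 1 := by
    rintro n hp ⟨t, ht⟩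
    have hl : -(2 * n + 1 : ℤ) = a + (-t) * (m * B) := by linear_combination -ht
    have hla : m ∣ -(2 * n + 1 : ℤ) - 1 := by
      rw [hl, add_sub_right_comm]
      exact dvd_add ha (Dvd.dvd.mul_left (dvd_mul_right _ _) _)
    have hlb : IsCoprime (-(2 * n + 1 : ℤ)) (m * B) := by
      rw [hl]
      exact hab'.add_mul_right_left _
    have hF : ((2 * n + 1 : ℕ) : ℤ) ∣ (m * B) ^ (2 * n) - 1 := by
      have := Int.ModEq.pow_card_sub_one_eq_one hp
        (n := m * B) (by push_cast; simpa using hlb.neg_left.symm)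
      simpa using this.symm.dvd
    obtain ⟨s, hs⟩ := hF
    push_cast at hs
    have h1 := sig_pow_mul_lam h4 rel hla (dvd_mul_right _ _) hlb n
    rw [← sig_left a (m * B) (-t) ha (dvd_mul_right _ _) hab', ← hl]
    refine mul_right_cancel (b := lam (-(2 * n + 1 : ℤ)) (2 * m)) ?_
    rw [h1, one_mul, ← lam_right _ (2 * m) (-s) hla dvd_rfl
      (isCoprime_two_mul_of_dvd_sub_one h4 hla)]
    congr 1
    linear_combination 2 * m * hs
  have h1 := orderOf_dvd_of_pow_eq_one (key n₁ hp₁ hd₁)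
  have h2 := orderOf_dvd_of_pow_eq_one (key n₂ hp₂ hd₂)
  exact orderOf_eq_one_iff.mp (Nat.dvd_one.mp (hcop ▸ Nat.dvd_gcd h1 h2))

/-- The symbol `lam` attached to the long roots is trivial on `a ≡ 1 mod 2m`. -/
lemma lam_eq_one (h4 : 4 ∣ m) (hm0 : m ≠ 0)
    (lam_one : ∀ b, 2 * m ∣ b → lam 1 b = 1)
    (lam_left : ∀ a b t, m ∣ a - 1 → 2 * m ∣ b → IsCoprime a b → lam (a + t * b) b = lam a b)
    (lam_right : ∀ a b t, m ∣ a - 1 → 2 * m ∣ b → IsCoprime a b →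
      lam a (b + 2 * m * t * a) = lam a b)
    (sig_left : ∀ a b t, m ∣ a - 1 → m ∣ b → IsCoprime a b → sig (a + t * b) b = sig a b)
    (sig_right : ∀ a b t, m ∣ a - 1 → m ∣ b → IsCoprime a b → sig a (b + m * t * a) = sig a b)
    (rel : ∀ a b c, m ∣ a - 1 → m ∣ b → 2 * m ∣ c → IsCoprime a b → IsCoprime a c →
      sig a b * lam a c = lam a (b ^ 2 * c))
    {a b : ℤ} (ha : 2 * m ∣ a - 1) (hb : 2 * m ∣ b) (hab : IsCoprime a b) : lam a b = 1 := by
  have ham : m ∣ a - 1 := (dvd_mul_left _ _).trans ha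
  obtain ⟨b, rfl⟩ := hb
  rcases eq_or_ne b 0 with rfl | hb0
  · obtain ⟨x, y, hxy⟩ := hab
    obtain ⟨m', rfl⟩ := h4
    obtain ⟨k, hk⟩ := ha
    have : a = 1 := by
      have hu : IsUnit a := IsUnit.of_mul_eq_one x (by linear_combination hxy)
      rcases Int.isUnit_iff.mp hu with h | h
      · exact h
      · have : -2 = 8 * (m' * k) := by linear_combination hk - h
        omega
    rw [this]
    exact lam_one _ (dvd_mul_right _ _)
  obtain ⟨p, hp, t, ht⟩ := exists_prime_dvd_sub
    (mul_ne_zero (mul_ne_zero two_ne_zero hm0) hb0) hab.neg_left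
  have : Fact p.Prime := ⟨hp⟩
  obtain ⟨l, hl⟩ : ∃ l : ℤ, l = -(p : ℤ) := ⟨_, rfl⟩
  have hl' : l = a + (-t) * (2 * m * b) := by linear_combination hl - ht
  have hla : 2 * m ∣ l - 1 := by
    rw [hl', add_sub_right_comm]
    exact dvd_add ha (Dvd.dvd.mul_left (dvd_mul_right _ _) _)
  have hlm : m ∣ l - 1 := (dvd_mul_left _ _).trans hla
  have hlb : IsCoprime l (2 * m * b) := by
    rw [hl']
    exact hab.add_mul_right_left _
  rw [← lam_left a _ (-t) ham (dvd_mul_right _ _) hab, ← hl']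
  have hp4 : p % 4 = 3 := by
    obtain ⟨m', rfl⟩ := h4
    obtain ⟨k, hk⟩ := hlm
    have : (p : ℤ) = 4 * (-(m' * k)) - 1 := by linear_combination hl - hk
    omega
  obtain ⟨r, ε, hε, hr⟩ : ∃ r ε : ℤ, ε ^ 2 = 1 ∧ (b ^ ((p + 1) / 4)) ^ 2 = ε * b + l * r := by
    have hbp : (b : ZMod p) ≠ 0 := by
      rw [Ne, ZMod.intCast_zmod_eq_zero_iff_dvd]
      intro h
      have := hlb.of_mul_right_right.isUnit_of_dvd' (by rw [hl]; exact dvd_neg.mpr dvd_rfl) h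
      exact (Nat.prime_iff_prime_int.mp hp).not_isUnit this
    have hexp : (p + 1) / 4 * 2 = p / 2 + 1 := by omega
    rcases ZMod.pow_div_two_eq_neg_one_or_one p hbp with h | h
    · have h1 : (((b ^ ((p + 1) / 4)) ^ 2 - b : ℤ) : ZMod p) = 0 := by
        push_cast
        rw [← pow_mul, hexp, pow_succ, h]
        ring
      obtain ⟨r, hr⟩ := (ZMod.intCast_zmod_eq_zero_iff_dvd _ _).mp h1
      exact ⟨-r, 1, by ring, by linear_combination hr + r * hl⟩
    · have h1 : (((b ^ ((p + 1) / 4)) ^ 2 + b : ℤ) : ZMod p) = 0 := by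
        push_cast
        rw [← pow_mul, hexp, pow_succ, h]
        ring
      obtain ⟨r, hr⟩ := (ZMod.intCast_zmod_eq_zero_iff_dvd _ _).mp h1
      exact ⟨-r, -1, by ring, by linear_combination hr + r * hl⟩
  obtain ⟨α, β, hαβ⟩ := hlb.of_mul_right_left.of_mul_right_right
  generalize hz : b ^ ((p + 1) / 4) = z at hr
  have hlz : IsCoprime l (m * β * z) := by
    rw [← hz]
    exact IsCoprime.mul_right ⟨α, 1, by linear_combination hαβ⟩ hlb.of_mul_right_right.pow_right
  have h2mε : IsCoprime l (2 * m * ε) :=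
    (isCoprime_two_mul_of_dvd_sub_one h4 hlm).mul_right ⟨0, ε, by linear_combination hε⟩
  have hb' : 2 * m * b = (m * β * z) ^ 2 * (2 * m * ε) +
      2 * m * (b * (2 * α - α ^ 2 * l) - ε * (1 - α * l) ^ 2 * r) * l := by
    linear_combination -2 * m * ε * (1 - α * l) ^ 2 * hr
      - 2 * m * ε * z ^ 2 * (m * β + 1 - α * l) * hαβ - 2 * m * b * (1 - α * l) ^ 2 * hε
  have hcop : IsCoprime l ((m * β * z) ^ 2 * (2 * m * ε)) := hlz.pow_right.mul_right h2mε
  rw [hb', lam_right _ _ _ hlm (Dvd.dvd.mul_left (dvd_mul_right _ _) _) hcop,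
    ← rel _ _ _ hlm (by rw [mul_assoc]; exact dvd_mul_right _ _) (dvd_mul_right _ _) hlz h2mε,
    sig_eq_one h4 hm0 lam_right sig_left sig_right rel hlm
      (by rw [mul_assoc]; exact dvd_mul_right _ _) hlz, one_mul]
  obtain ⟨k, hk⟩ := hla
  have hl1 : l = 1 + (ε * k) * (2 * m * ε) := by linear_combination hk - 2 * m * k * hε
  rw [hl1, lam_left 1 _ _ (by simp) (dvd_mul_right _ _) isCoprime_one_left]
  exact lam_one _ (dvd_mul_right _ _)

end SymbolArithmetic

section SymplecticForm

/-- The standard symplectic form on `ℤ^{2g}`. -/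
def om {g : ℕ} : (Idx g → ℤ) →ₗ[ℤ] (Idx g → ℤ) →ₗ[ℤ] ℤ :=
  LinearMap.mk₂ ℤ (fun x y => ∑ i, (x (Sum.inl i) * y (Sum.inr i) - x (Sum.inr i) * y (Sum.inl i)))
    (fun x x' y => by
      rw [← Finset.sum_add_distrib]
      exact Finset.sum_congr rfl fun i _ => by simp only [Pi.add_apply]; ring)
    (fun c x y => by
      rw [smul_eq_mul, Finset.mul_sum]
      exact Finset.sum_congr rfl fun i _ => by simp only [Pi.smul_apply, smul_eq_mul]; ring)
    (fun x y y' => by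
      rw [← Finset.sum_add_distrib]
      exact Finset.sum_congr rfl fun i _ => by simp only [Pi.add_apply]; ring)
    (fun c x y => by
      rw [smul_eq_mul, Finset.mul_sum]
      exact Finset.sum_congr rfl fun i _ => by simp only [Pi.smul_apply, smul_eq_mul]; ring)

/-- The basis vector `e_i`. -/
abbrev ve {g : ℕ} (i : Fin g) : Idx g → ℤ := Pi.single (Sum.inl i) 1

/-- The basis vector `f_i`. -/
abbrev vf {g : ℕ} (i : Fin g) : Idx g → ℤ := Pi.single (Sum.inr i) 1

variable {g : ℕ}

lemma om_apply (x y : Idx g → ℤ) :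
    om x y = ∑ i, (x (Sum.inl i) * y (Sum.inr i) - x (Sum.inr i) * y (Sum.inl i)) := rfl

lemma om_add_left (x y z : Idx g → ℤ) : om (x + y) z = om x z + om y z := by
  rw [map_add, LinearMap.add_apply]

lemma om_smul_left (c : ℤ) (x z : Idx g → ℤ) : om (c • x) z = c * om x z := by
  rw [map_smul, LinearMap.smul_apply, smul_eq_mul]

lemma om_neg_left (x z : Idx g → ℤ) : om (-x) z = -om x z := by
  rw [map_neg, LinearMap.neg_apply]

lemma om_add_right (x y z : Idx g → ℤ) : om x (y + z) = om x y + om x z := map_add _ _ _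

lemma om_smul_right (c : ℤ) (x z : Idx g → ℤ) : om x (c • z) = c * om x z := map_smul _ _ _

lemma om_neg_right (x z : Idx g → ℤ) : om x (-z) = -om x z := map_neg _ _

lemma om_swap (x y : Idx g → ℤ) : om y x = -om x y := by
  rw [om_apply, om_apply, ← Finset.sum_neg_distrib]
  exact Finset.sum_congr rfl fun i _ => by ring

@[simp] lemma om_self (x : Idx g → ℤ) : om x x = 0 := by
  rw [om_apply]
  exact Finset.sum_eq_zero fun i _ => by ring

@[simp] lemma om_ve (x : Idx g → ℤ) (i : Fin g) : om x (ve i) = -x (Sum.inr i) := by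
  simp [om_apply, ve, Pi.single_apply]

@[simp] lemma om_vf (x : Idx g → ℤ) (i : Fin g) : om x (vf i) = x (Sum.inl i) := by
  simp [om_apply, vf, Pi.single_apply]

@[simp] lemma ve_om (x : Idx g → ℤ) (i : Fin g) : om (ve i) x = x (Sum.inr i) := by
  rw [om_swap, om_ve, neg_neg]

@[simp] lemma vf_om (x : Idx g → ℤ) (i : Fin g) : om (vf i) x = -x (Sum.inl i) := by
  rw [om_swap, om_vf]

lemma om_eq_dotProduct (x y : Idx g → ℤ) : om x y = -(x ⬝ᵥ (J (Fin g) ℤ *ᵥ y)) := by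
  have h (y : Idx g → ℤ) :
      J (Fin g) ℤ *ᵥ y = Sum.elim (fun i => - y (Sum.inr i)) (fun i => y (Sum.inl i)) := by
    rw [J, ← Sum.elim_comp_inl_inr y, fromBlocks_mulVec]
    ext i
    rcases i with i | i <;> simp [Matrix.neg_mulVec]
  rw [h, om_apply, dotProduct, Fintype.sum_sum_type, ← Finset.sum_add_distrib,
    ← Finset.sum_neg_distrib]
  exact Finset.sum_congr rfl fun i _ => by simp only [Sum.elim_inl, Sum.elim_inr]; ring

/-- The linear action of the symplectic group on `ℤ^{2g}`. -/
def act : SpZ g →* Module.End ℤ (Idx g → ℤ) :=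
  (Matrix.toLinAlgEquiv' : Matrix (Idx g) (Idx g) ℤ ≃ₐ[ℤ] _).toMonoidHom.comp (SpZ g).subtype

lemma act_apply (A : SpZ g) (x : Idx g → ℤ) : act A x = A.1 *ᵥ x := rfl

lemma act_mul (A B : SpZ g) (x : Idx g → ℤ) : act (A * B) x = act A (act B x) := by
  rw [map_mul, Module.End.mul_apply]

@[simp] lemma act_one (x : Idx g → ℤ) : act 1 x = x := by
  rw [map_one, Module.End.one_apply]

@[simp] lemma act_inv_act (A : SpZ g) (x : Idx g → ℤ) : act A⁻¹ (act A x) = x := by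
  rw [← act_mul, inv_mul_cancel, act_one]

@[simp] lemma act_act_inv (A : SpZ g) (x : Idx g → ℤ) : act A (act A⁻¹ x) = x := by
  rw [← act_mul, mul_inv_cancel, act_one]

lemma act_entry (A : SpZ g) (i j : Idx g) : A.1 i j = act A (Pi.single j 1) i := by
  simp [act_apply]

lemma act_ext {A B : SpZ g} (h : ∀ x, act A x = act B x) : A = B := by
  refine Subtype.ext (Matrix.ext fun i j => ?_)
  rw [act_entry, act_entry, h]

lemma act_ext_basis {A B : SpZ g} (h : ∀ i, act A (ve i) = act B (ve i))
    (h' : ∀ i, act A (vf i) = act B (vf i)) : A = B := by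
  refine Subtype.ext (Matrix.ext fun i j => ?_)
  rw [act_entry, act_entry]
  rcases j with j | j
  · exact congrFun (h j) i
  · exact congrFun (h' j) i

lemma om_mulVec_mulVec (A : Matrix (Idx g) (Idx g) ℤ) (x y : Idx g → ℤ) :
    om (A *ᵥ x) (A *ᵥ y) = -(x ⬝ᵥ ((Aᵀ * J (Fin g) ℤ * A) *ᵥ y)) := by
  rw [om_eq_dotProduct, ← mulVec_mulVec, ← mulVec_mulVec, dotProduct_mulVec x Aᵀ, vecMul_transpose]

lemma om_act_act (A : SpZ g) (x y : Idx g → ℤ) : om (act A x) (act A y) = om x y := by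
  rw [act_apply, act_apply, om_mulVec_mulVec, SymplecticGroup.mem_iff'.mp A.2, om_eq_dotProduct]

lemma om_act_left (A : SpZ g) (x y : Idx g → ℤ) : om (act A x) y = om x (act A⁻¹ y) := by
  rw [← om_act_act A x, act_act_inv]

/-- A linear endomorphism preserving the symplectic form, as an element of `Sp(2g; ℤ)`. -/
def mkSp (f : (Idx g → ℤ) →ₗ[ℤ] (Idx g → ℤ)) (h : ∀ x y, om (f x) (f y) = om x y) : SpZ g :=
  ⟨LinearMap.toMatrix' f, by
    rw [SymplecticGroup.mem_iff']
    ext i j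
    have := h (Pi.single i 1) (Pi.single j 1)
    rw [← LinearMap.toMatrix'_mulVec, ← LinearMap.toMatrix'_mulVec, om_mulVec_mulVec,
      om_eq_dotProduct, neg_inj] at this
    simpa using this⟩

@[simp] lemma act_mkSp (f : (Idx g → ℤ) →ₗ[ℤ] (Idx g → ℤ))
    (h : ∀ x y, om (f x) (f y) = om x y) (x : Idx g → ℤ) : act (mkSp f h) x = f x := by
  rw [act_apply, mkSp, LinearMap.toMatrix'_mulVec]

end SymplecticForm

section Transvections

variable {g : ℕ}

/-- The symplectic transvection `z ↦ z + k ω(z, e) e`. -/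
def TV (e : Idx g → ℤ) (k : ℤ) : SpZ g :=
  mkSp (LinearMap.id + (k • om.flip e).smulRight e) fun x y => by
    simp only [LinearMap.add_apply, LinearMap.id_apply, LinearMap.smulRight_apply,
      LinearMap.smul_apply, LinearMap.flip_apply, om_add_left, om_smul_left, om_add_right,
      om_smul_right, om_self, smul_eq_mul, om_swap y e]
    ring

lemma act_TV (e : Idx g → ℤ) (k : ℤ) (x : Idx g → ℤ) :
    act (TV e k) x = x + (k * om x e) • e := by
  rw [TV, act_mkSp]
  simp

/-- The Eichler transvection `z ↦ z + ω(z, e) u + ω(z, u) e` for `ω(e, u) = 0`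
(and the identity otherwise). -/
def ET (e u : Idx g → ℤ) : SpZ g :=
  if h : om e u = 0 then
    mkSp (LinearMap.id + (om.flip e).smulRight u + (om.flip u).smulRight e) fun x y => by
      simp only [LinearMap.add_apply, LinearMap.id_apply, LinearMap.smulRight_apply,
        LinearMap.flip_apply, om_add_left, om_smul_left, om_add_right, om_smul_right, om_self,
        om_swap y e, om_swap y u, h, om_swap e u]
      ring
  else 1

lemma act_ET {e u : Idx g → ℤ} (h : om e u = 0) (x : Idx g → ℤ) :
    act (ET e u) x = x + om x e • u + om x u • e := by
  rw [ET, dif_pos h, act_mkSp]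
  simp

lemma om_eq_zero_swap {e u : Idx g → ℤ} (h : om e u = 0) : om u e = 0 := by
  rw [om_swap, h, neg_zero]

lemma ET_comm (e u : Idx g → ℤ) : ET e u = ET u e := by
  by_cases h : om e u = 0
  · refine act_ext fun x => ?_
    rw [act_ET h, act_ET (om_eq_zero_swap h)]
    abel
  · rw [ET, dif_neg h, ET, dif_neg fun h' => h (om_eq_zero_swap h')]

lemma conj_TV (A : SpZ g) (e : Idx g → ℤ) (k : ℤ) : A * TV e k * A⁻¹ = TV (act A e) k := by
  refine act_ext fun x => ?_
  rw [act_mul, act_mul, act_TV, act_TV, map_add, map_smul, act_act_inv, om_act_left, inv_inv]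

lemma conj_ET (A : SpZ g) (e u : Idx g → ℤ) : A * ET e u * A⁻¹ = ET (act A e) (act A u) := by
  by_cases h : om e u = 0
  · refine act_ext fun x => ?_
    rw [act_mul, act_mul, act_ET h, act_ET (by rw [om_act_act, h]), map_add, map_add, map_smul,
      map_smul, act_act_inv, om_act_left, om_act_left, inv_inv]
  · rw [ET, dif_neg h, ET, dif_neg (by rwa [om_act_act])]
    simp

lemma TV_zero (e : Idx g → ℤ) : TV e 0 = 1 :=
  act_ext fun x => by rw [act_TV]; simp

lemma TV_add (e : Idx g → ℤ) (k l : ℤ) : TV e (k + l) = TV e k * TV e l := by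
  refine act_ext fun x => ?_
  simp only [act_mul, act_TV, om_add_left, om_smul_left, om_self]
  module

lemma TV_neg (e : Idx g → ℤ) (k : ℤ) : TV e (-k) = (TV e k)⁻¹ := by
  rw [eq_inv_iff_mul_eq_one, ← TV_add, neg_add_cancel, TV_zero]

lemma TV_smul (e : Idx g → ℤ) (c k : ℤ) : TV (c • e) k = TV e (c ^ 2 * k) := by
  refine act_ext fun x => ?_
  simp only [act_TV, om_smul_right]
  module

lemma ET_smul_smul (e u : Idx g → ℤ) (c k : ℤ) (h : om e u = 0) :
    ET (c • e) (k • u) = ET e ((c * k) • u) := by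
  refine act_ext fun x => ?_
  rw [act_ET (by rw [om_smul_left, om_smul_right, h, mul_zero, mul_zero]),
    act_ET (by rw [om_smul_right, h, mul_zero])]
  simp only [om_smul_right]
  module

lemma ET_smul_left (e u : Idx g → ℤ) (c : ℤ) (h : om e u = 0) :
    ET (c • e) u = ET e (c • u) := by
  simpa using ET_smul_smul e u c 1 h

lemma ET_smul_self (e : Idx g → ℤ) (k : ℤ) : ET e (k • e) = TV e (2 * k) := by
  refine act_ext fun x => ?_
  rw [act_ET (by rw [om_smul_right, om_self, mul_zero]), act_TV]
  simp only [om_smul_right]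
  module

lemma ET_add {e u v : Idx g → ℤ} (hu : om e u = 0) (hv : om e v = 0) :
    ET e (u + v) * TV e (om v u) = ET e u * ET e v := by
  refine act_ext fun x => ?_
  have := om_eq_zero_swap hu
  have := om_eq_zero_swap hv
  simp only [act_mul, act_TV, act_ET hu, act_ET hv, act_ET (show om e (u + v) = 0 by simp [*]),
    om_add_left, om_smul_left, om_add_right, om_self, *]
  module

lemma ET_add' {e u v : Idx g → ℤ} (hu : om e u = 0) (hv : om e v = 0) (huv : om v u = 0) :
    ET e (u + v) = ET e u * ET e v := by
  rw [← ET_add hu hv, huv, TV_zero, mul_one]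

lemma ET_zero (e : Idx g → ℤ) : ET e 0 = 1 := by
  refine act_ext fun x => ?_
  rw [act_ET (by simp)]
  simp

lemma ET_neg {e u : Idx g → ℤ} (hu : om e u = 0) : ET e (-u) = (ET e u)⁻¹ := by
  rw [eq_inv_iff_mul_eq_one, ← ET_add' (by rw [om_neg_right, hu, neg_zero]) hu (by simp),
    neg_add_cancel, ET_zero]

lemma TV_add_vec {x y : Idx g → ℤ} (h : om x y = 0) (k : ℤ) :
    TV (x + y) k = TV x k * ET x (k • y) * TV y k := by
  refine act_ext fun z => ?_
  have := om_eq_zero_swap h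
  simp only [act_mul, act_TV, act_ET (show om x (k • y) = 0 by rw [om_smul_right, h, mul_zero]),
    om_add_left,
    om_smul_left, om_add_right, om_smul_right, om_self, *]
  module

lemma ET_smul_mem {K : Subgroup (SpZ g)} {e u : Idx g → ℤ} (h : om e u = 0) (hK : ET e u ∈ K)
    (c : ℤ) : ET e (c • u) ∈ K := by
  have (n : ℕ) : ET e ((n : ℤ) • u) = ET e u ^ n := by
    induction n with
    | zero => simp [ET_zero]
    | succ n ih =>
      rw [pow_succ, ← ih, ← ET_add' (by rw [om_smul_right, h, mul_zero]) h
        (by rw [om_smul_right, om_self, mul_zero])]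
      congr 1
      push_cast
      module
  obtain ⟨n, rfl | rfl⟩ := c.eq_nat_or_neg
  · rw [this]
    exact pow_mem hK n
  · rw [neg_smul, ET_neg (by rw [om_smul_right, h, mul_zero]), this]
    exact inv_mem (pow_mem hK n)

lemma TV_mul_mem {K : Subgroup (SpZ g)} {e : Idx g → ℤ} {k : ℤ} (hK : TV e k ∈ K)
    (c : ℤ) : TV e (k * c) ∈ K := by
  have (n : ℕ) : TV e (k * n) = TV e k ^ n := by
    induction n with
    | zero => simp [TV_zero]
    | succ n ih =>
      rw [pow_succ, ← ih, ← TV_add]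
      congr 1
      push_cast
      ring
  obtain ⟨n, rfl | rfl⟩ := c.eq_nat_or_neg
  · rw [this]
    exact pow_mem hK n
  · rw [mul_neg, TV_neg, this]
    exact inv_mem (pow_mem hK n)

lemma TV_mem_of_dvd {K : Subgroup (SpZ g)} {e : Idx g → ℤ} {k l : ℤ} (hK : TV e k ∈ K)
    (h : k ∣ l) : TV e l ∈ K := by
  obtain ⟨c, rfl⟩ := h
  exact TV_mul_mem hK c

/-- A symplectic matrix lies in the level `d` subgroup iff it fixes all vectors mod `d`. -/
lemma mem_Gamma_of_act {d : ℕ} {A : SpZ g} (h : ∀ x, ∃ y, act A x = x + (d : ℤ) • y) :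
    A ∈ Gamma g d := by
  rw [mem_Gamma_iff]
  intro i j
  obtain ⟨y, hy⟩ := h (Pi.single j 1)
  rw [act_entry, hy, Matrix.one_apply, Pi.add_apply, Pi.single_apply, Pi.smul_apply]
  simp

lemma TV_mem_Gamma {d : ℕ} (e : Idx g → ℤ) (k : ℤ) : TV e (d * k) ∈ Gamma g d :=
  mem_Gamma_of_act fun x => ⟨(k * om x e) • e, by rw [act_TV, mul_assoc, mul_smul]⟩

lemma ET_mem_Gamma {d : ℕ} {e u : Idx g → ℤ} (h : om e u = 0) : ET e ((d : ℤ) • u) ∈ Gamma g d :=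
  mem_Gamma_of_act fun x => ⟨om x e • u + om x u • e, by
    rw [act_ET (by rw [om_smul_right, h, mul_zero]), map_smul, smul_eq_mul]; module⟩

instance Gamma_normal (d : ℕ) : (Gamma g d).Normal := by
  have : Gamma g d = ((modred g d).toMonoidHom.comp (SpZ g).subtype).ker := by
    ext A
    rw [MonoidHom.mem_ker]
    rfl
  rw [this]
  infer_instance

end Transvections

section CommutatorLe

variable {g d : ℕ}

lemma exists_eq_one_add_of_mem_Gamma {A : SpZ g} (hA : A ∈ Gamma g d) :
    ∃ X : Matrix (Idx g) (Idx g) ℤ, A.1 = 1 + (d : ℤ) • X := by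
  choose X hX using mem_Gamma_iff.mp hA
  refine ⟨Matrix.of X, Matrix.ext fun i j => ?_⟩
  simp only [Matrix.add_apply, Matrix.smul_apply, Matrix.of_apply, smul_eq_mul, ← hX]
  ring

lemma two_dvd_om_add (hd : Even d) (hd0 : d ≠ 0) {A : SpZ g} {X : Matrix (Idx g) (Idx g) ℤ}
    (hX : A.1 = 1 + (d : ℤ) • X) (x y : Idx g → ℤ) : 2 ∣ om (X *ᵥ x) y + om x (X *ᵥ y) := by
  have h := om_act_act A x y
  simp only [act_apply, hX, add_mulVec, one_mulVec, smul_mulVec, om_add_left, om_add_right,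
    om_smul_left, om_smul_right] at h
  have h2 : (d : ℤ) * (om (X *ᵥ x) y + om x (X *ᵥ y)) = d * (-d * om (X *ᵥ x) (X *ᵥ y)) := by
    linear_combination h
  rw [mul_left_cancel₀ (by exact_mod_cast hd0) h2]
  exact Dvd.dvd.mul_right (dvd_neg.mpr (by exact_mod_cast hd.two_dvd)) _

lemma two_dvd_om_lie (hd : Even d) (hd0 : d ≠ 0) {A B : SpZ g} {X Y : Matrix (Idx g) (Idx g) ℤ}
    (hX : A.1 = 1 + (d : ℤ) • X) (hY : B.1 = 1 + (d : ℤ) • Y) (x : Idx g → ℤ) :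
    2 ∣ om ((X * Y - Y * X) *ᵥ x) x := by
  obtain ⟨a, ha⟩ := two_dvd_om_add hd hd0 hX (Y *ᵥ x) x
  obtain ⟨b, hb⟩ := two_dvd_om_add hd hd0 hY (X *ᵥ x) x
  rw [sub_mulVec, ← mulVec_mulVec, ← mulVec_mulVec, map_sub, LinearMap.sub_apply]
  exact ⟨a - b + om (X *ᵥ x) (Y *ᵥ x), by
    linear_combination ha - hb - om_swap (X *ᵥ x) (Y *ᵥ x)⟩

lemma commutator_le_GammaMod (hd : Even d) (hd0 : d ≠ 0) (h : Even (d ^ 2)) :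
    ⁅Gamma g d, Gamma g d⁆ ≤ GammaMod g (d ^ 2) h := by
  rw [Subgroup.commutator_le]
  intro A hA B hB
  rw [commutatorElement_def]
  obtain ⟨X, hX⟩ := exists_eq_one_add_of_mem_Gamma hA
  obtain ⟨Y, hY⟩ := exists_eq_one_add_of_mem_Gamma hB
  obtain ⟨Z, hZ⟩ := exists_eq_one_add_of_mem_Gamma (inv_mem (mul_mem hB hA))
  have hC : (A * B * A⁻¹ * B⁻¹).1 =
      1 + ((d ^ 2 : ℕ) : ℤ) • ((X * Y - Y * X) + (d : ℤ) • ((X * Y - Y * X) * Z)) := by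
    have h1 : (B * A).1 * ((B * A)⁻¹ : SpZ g).1 = 1 := by
      rw [← Submonoid.coe_mul, mul_inv_cancel, Submonoid.coe_one]
    have h2 : (A * B).1 = (B * A).1 + ((d ^ 2 : ℕ) : ℤ) • (X * Y - Y * X) := by
      simp only [Submonoid.coe_mul, hX, hY, add_mul, mul_add, one_mul, mul_one, smul_mul_assoc,
        mul_smul_comm, smul_sub]
      push_cast
      module
    rw [show A * B * A⁻¹ * B⁻¹ = A * B * (B * A)⁻¹ by group, Submonoid.coe_mul, h2, add_mul, h1, hZ]
    simp only [mul_add, mul_one, smul_mul_assoc, mul_smul_comm]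
    rw [smul_add, smul_comm (d : ℤ)]
  have hpar (x : Idx g → ℤ) :
      2 ∣ om (((X * Y - Y * X) + (d : ℤ) • ((X * Y - Y * X) * Z)) *ᵥ x) x := by
    rw [add_mulVec, smul_mulVec, om_add_left, om_smul_left]
    exact dvd_add (two_dvd_om_lie hd hd0 hX hY x)
      (Dvd.dvd.mul_right (by exact_mod_cast hd.two_dvd) _)
  generalize (X * Y - Y * X) + (d : ℤ) • ((X * Y - Y * X) * Z) = W at hC hpar
  refine ⟨mem_Gamma_iff.mpr fun i j => ⟨W i j, ?_⟩, fun i => ⟨?_, ?_⟩⟩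
  · rw [hC, Matrix.add_apply, Matrix.smul_apply, smul_eq_mul]
    ring
  · have := hpar (vf i)
    rw [om_vf, mulVec_single_one, Matrix.col_apply] at this
    rw [hC, Matrix.add_apply, Matrix.smul_apply, smul_eq_mul, Matrix.one_apply_ne (by simp),
      zero_add, mul_comm]
    exact mul_dvd_mul_left _ this
  · have := hpar (ve i)
    rw [om_ve, mulVec_single_one, Matrix.col_apply, dvd_neg] at this
    rw [hC, Matrix.add_apply, Matrix.smul_apply, smul_eq_mul, Matrix.one_apply_ne (by simp),
      zero_add, mul_comm]
    exact mul_dvd_mul_left _ this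

end CommutatorLe

section CommutatorMembership

open scoped commutatorElement

variable {g d : ℕ}

/-- The commutator subgroup of `Γ_g[d]`. -/
abbrev commGamma (g d : ℕ) : Subgroup (SpZ g) := ⁅Gamma g d, Gamma g d⁆

/-- The vectors whose `i`-th coordinates (both `e_i` and `f_i`) vanish. -/
def slotPerp (i : Fin g) : Submodule ℤ (Idx g → ℤ) where
  carrier := {u | u (Sum.inl i) = 0 ∧ u (Sum.inr i) = 0}
  zero_mem' := by constructor <;> rfl
  add_mem' := by
    rintro a b ⟨ha, ha'⟩ ⟨hb, hb'⟩
    exact ⟨by rw [Pi.add_apply, ha, hb, add_zero], by rw [Pi.add_apply, ha', hb', add_zero]⟩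
  smul_mem' := by
    rintro c a ⟨ha, ha'⟩
    exact ⟨by rw [Pi.smul_apply, ha, smul_zero], by rw [Pi.smul_apply, ha', smul_zero]⟩

lemma mem_slotPerp {i : Fin g} {u : Idx g → ℤ} :
    u ∈ slotPerp i ↔ u (Sum.inl i) = 0 ∧ u (Sum.inr i) = 0 := Iff.rfl

lemma ve_om_of_mem {i : Fin g} {u : Idx g → ℤ} (hu : u ∈ slotPerp i) : om (ve i) u = 0 := by
  rw [ve_om, hu.2]

lemma vf_om_of_mem {i : Fin g} {u : Idx g → ℤ} (hu : u ∈ slotPerp i) : om (vf i) u = 0 := by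
  rw [vf_om, hu.1, neg_zero]

lemma om_ve_of_mem {i : Fin g} {u : Idx g → ℤ} (hu : u ∈ slotPerp i) : om u (ve i) = 0 := by
  rw [om_ve, hu.2, neg_zero]

lemma om_vf_of_mem {i : Fin g} {u : Idx g → ℤ} (hu : u ∈ slotPerp i) : om u (vf i) = 0 := by
  rw [om_vf, hu.1]

/-- The projection of a vector to `slotPerp i`. -/
def slotProj (i : Fin g) (x : Idx g → ℤ) : Idx g → ℤ :=
  x - x (Sum.inl i) • ve i - x (Sum.inr i) • vf i

lemma slotProj_mem (i : Fin g) (x : Idx g → ℤ) : slotProj i x ∈ slotPerp i := by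
  constructor <;> simp [slotProj]

lemma eq_add_slotProj (i : Fin g) (x : Idx g → ℤ) :
    x = x (Sum.inl i) • ve i + x (Sum.inr i) • vf i + slotProj i x := by
  rw [slotProj]
  abel

lemma exists_hyperbolic_of_mem_slotPerp (hg : 2 ≤ g) {i : Fin g} {w : Idx g → ℤ}
    (hw : w ∈ slotPerp i) : ∃ (c : ℤ) (y y' : Idx g → ℤ), y ∈ slotPerp i ∧ y' ∈ slotPerp i ∧
      om y y' = 1 ∧ w = c • y := by
  by_cases hw0 : w = 0
  · have : Nontrivial (Fin g) := Fin.nontrivial_iff_two_le.mpr hg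
    obtain ⟨j, hj⟩ := exists_ne i
    exact ⟨0, ve j, vf j, by simp [mem_slotPerp, hj.symm], by simp [mem_slotPerp, hj.symm],
      by simp, by simp [hw0]⟩
  · obtain ⟨c, hc⟩ := (IsPrincipalIdealRing.principal (Ideal.span (Set.range w))).principal
    have hwc (k) : ∃ y, w k = c * y := by
      have : w k ∈ Ideal.span (Set.range w) := Ideal.subset_span ⟨k, rfl⟩
      rw [hc] at this
      exact (Ideal.mem_span_singleton.mp this)
    choose y hy using hwc
    have hcs : c ∈ Ideal.span (Set.range w) := by
      rw [hc]
      exact Ideal.mem_span_singleton_self c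
    obtain ⟨s, hs⟩ := (Ideal.mem_span_range_iff_exists_fun).mp hcs
    have hc0 : c ≠ 0 := by
      rintro rfl
      exact hw0 (funext fun k => by rw [hy, zero_mul, Pi.zero_apply])
    have hyw : w = c • y := funext fun k => hy k
    have hyi : y ∈ slotPerp i := by
      refine ⟨?_, ?_⟩
      · exact (mul_eq_zero.mp ((hy _).symm.trans hw.1)).resolve_left hc0
      · exact (mul_eq_zero.mp ((hy _).symm.trans hw.2)).resolve_left hc0
    have hsy : ∑ k, s k * y k = 1 := by
      apply mul_left_cancel₀ hc0
      rw [Finset.mul_sum, mul_one]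
      refine Eq.trans (Finset.sum_congr rfl fun k _ => ?_) hs
      rw [hy]
      ring
    let z : Idx g → ℤ := Sum.elim (fun j => -s (Sum.inr j)) (fun j => s (Sum.inl j))
    refine ⟨c, y, slotProj i z, hyi, slotProj_mem _ _, ?_, hyw⟩
    have : om y z = 1 := by
      rw [← hsy, om_apply, Fintype.sum_sum_type, ← Finset.sum_add_distrib]
      exact Finset.sum_congr rfl fun j _ => by simp only [z, Sum.elim_inl, Sum.elim_inr]; ring
    rw [slotProj, map_sub, map_sub, om_smul_right, om_smul_right, om_ve_of_mem hyi,
      om_vf_of_mem hyi, this]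
    ring

lemma exists_hyperbolic (hg : 2 ≤ g) (i : Fin g) :
    ∃ y y' : Idx g → ℤ, y ∈ slotPerp i ∧ y' ∈ slotPerp i ∧ om y y' = 1 := by
  obtain ⟨_, y, y', hy, hy', h, -⟩ := exists_hyperbolic_of_mem_slotPerp hg (slotPerp i).zero_mem
  exact ⟨y, y', hy, hy', h⟩

lemma TV_mem_commGamma {e x x' : Idx g → ℤ} (hx : om e x = 0) (hx' : om e x' = 0)
    (hxx' : om x x' = 1) {k : ℤ} (hk : 2 * (d : ℤ) ^ 2 ∣ k) : TV e k ∈ commGamma g d := by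
  have h1 := Subgroup.commutator_mem_commutator (ET_mem_Gamma (d := d) hx')
    (ET_mem_Gamma (d := d) hx)
  have hu : om e ((d : ℤ) • x) = 0 := by rw [om_smul_right, hx, mul_zero]
  have hu' : om e ((d : ℤ) • x') = 0 := by rw [om_smul_right, hx', mul_zero]
  have h2 : ⁅ET e ((d : ℤ) • x'), ET e ((d : ℤ) • x)⁆ = TV e (2 * (d : ℤ) ^ 2) := by
    rw [commutatorElement_def, mul_assoc, ← _root_.mul_inv_rev, ← ET_add hu hu', ← ET_add hu' hu,
      add_comm, _root_.mul_inv_rev, ← TV_neg, ← mul_assoc, mul_assoc (ET _ _), ← TV_add, conj_TV,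
      act_ET]
    · simp only [om_smul_left, om_smul_right, om_add_right, hx, hx', hxx', om_swap x x', om_self]
      congr 1
      · module
      · ring
    · rw [om_add_right, hu, hu', zero_add]
  rw [h2] at h1
  exact TV_mem_of_dvd h1 hk

lemma ET_mem_commGamma_aux (hd : Even d) {e x x' : Idx g → ℤ} (hx : om e x = 0)
    (hx' : om e x' = 0) (hxx' : om x x' = 1) : ET e ((d : ℤ) ^ 2 • x) ∈ commGamma g d := by
  have h1 := Subgroup.commutator_mem_commutator (TV_mem_Gamma (d := d) x 1)
    (ET_mem_Gamma (d := d) hx')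
  have h2 : ⁅TV x (d * 1), ET e ((d : ℤ) • x')⁆ =
      ET e (-(d : ℤ) ^ 2 • x) * TV e (-(d : ℤ) ^ 3) := by
    have h3 : act (ET e ((d : ℤ) • x')) x = x + (d : ℤ) • e := by
      rw [act_ET (by rw [om_smul_right, hx', mul_zero]), om_smul_right, hxx', om_swap, hx]
      module
    rw [commutatorElement_def, mul_assoc, mul_assoc, ← mul_assoc (ET _ _), ← TV_neg, conj_TV, h3,
      TV_add_vec (by rw [om_smul_right, om_swap, hx]; simp), ← mul_assoc, ← mul_assoc, ← TV_add,
      mul_one, add_neg_cancel, TV_zero, one_mul, smul_smul, ← ET_smul_left, ET_comm, TV_smul]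
    · congr 2
      · congr 1; ring
      · ring
    · rw [om_swap, hx, neg_zero]
  rw [h2] at h1
  have h3 : TV e (-(d : ℤ) ^ 3) ∈ commGamma g d := by
    refine TV_mem_commGamma hx hx' hxx' ?_
    obtain ⟨b, hb⟩ := hd.two_dvd
    exact ⟨-b, by rw [hb]; push_cast; ring⟩
  have h4 := ET_smul_mem (by rw [om_smul_right, hx, mul_zero])
    ((Subgroup.mul_mem_cancel_right _ h3).mp h1) (-1)
  simpa using h4

/-- Eichler transvections along a slot plane, by `d²` times a vector orthogonal to that slot. -/
lemma ET_mem_commGamma (hg : 2 ≤ g) (hd : Even d) {i : Fin g} {e u : Idx g → ℤ}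
    (he : ∀ x ∈ slotPerp i, om e x = 0) (hu : u ∈ slotPerp i) :
    ET e ((d : ℤ) ^ 2 • u) ∈ commGamma g d := by
  obtain ⟨c, y, y', hy, hy', hyy', rfl⟩ := exists_hyperbolic_of_mem_slotPerp hg hu
  rw [smul_comm]
  exact ET_smul_mem (by rw [om_smul_right, he y hy, mul_zero])
    (ET_mem_commGamma_aux hd (he y hy) (he y' hy') hyy') c

lemma TV_mem_commGamma_of_slot (hg : 2 ≤ g) {i : Fin g} {e : Idx g → ℤ}
    (he : ∀ x ∈ slotPerp i, om e x = 0) {k : ℤ} (hk : 2 * (d : ℤ) ^ 2 ∣ k) :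
    TV e k ∈ commGamma g d := by
  obtain ⟨y, y', hy, hy', hyy'⟩ := exists_hyperbolic hg i
  exact TV_mem_commGamma (he y hy) (he y' hy') hyy' hk

lemma TV_mem_commGamma_of_mem_slotPerp {i : Fin g} {e : Idx g → ℤ}
    (he : e ∈ slotPerp i) {k : ℤ} (hk : 2 * (d : ℤ) ^ 2 ∣ k) :
    TV e k ∈ commGamma g d :=
  TV_mem_commGamma (om_ve_of_mem he) (om_vf_of_mem he) (by simp) hk

lemma om_slot_of_mem {i : Fin g} (a b : ℤ) {x : Idx g → ℤ} (hx : x ∈ slotPerp i) :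
    om (a • ve i + b • vf i) x = 0 := by
  rw [om_add_left, om_smul_left, om_smul_left, ve_om_of_mem hx, vf_om_of_mem hx]
  simp

lemma ET_smul_add_mem_commGamma (hg : 2 ≤ g) (hd : Even d) {i : Fin g} {e u : Idx g → ℤ}
    (he : ∀ x ∈ slotPerp i, om e x = 0) (k : ℤ) (hu : u ∈ slotPerp i) :
    ET e ((d : ℤ) ^ 2 • (k • e + u)) ∈ commGamma g d := by
  rw [smul_add, ET_add', smul_smul, ET_smul_self]
  · exact mul_mem (TV_mem_commGamma_of_slot hg he ⟨k, by ring⟩) (ET_mem_commGamma hg hd he hu)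
  · rw [om_smul_right, om_smul_right, om_self, mul_zero, mul_zero]
  · rw [om_smul_right, he u hu, mul_zero]
  · rw [om_smul_right, om_smul_right, om_smul_left, om_swap, he u hu]
    ring

/-- `ET e_i (d² q)` is a commutator for every `q` orthogonal to `e_i`. -/
lemma ET_ve_mem_commGamma (hg : 2 ≤ g) (hd : Even d) (i : Fin g) {q : Idx g → ℤ}
    (hq : om (ve i) q = 0) : ET (ve i) ((d : ℤ) ^ 2 • q) ∈ commGamma g d := by
  rw [ve_om] at hq
  rw [eq_add_slotProj i q, hq, zero_smul, add_zero]
  exact ET_smul_add_mem_commGamma hg hd (fun x hx => ve_om_of_mem hx) _ (slotProj_mem i q)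

/-- `ET f_i (d² q)` is a commutator for every `q` orthogonal to `f_i`. -/
lemma ET_vf_mem_commGamma (hg : 2 ≤ g) (hd : Even d) (i : Fin g) {q : Idx g → ℤ}
    (hq : om (vf i) q = 0) : ET (vf i) ((d : ℤ) ^ 2 • q) ∈ commGamma g d := by
  rw [vf_om, neg_eq_zero] at hq
  rw [eq_add_slotProj i q, hq, zero_smul, zero_add]
  exact ET_smul_add_mem_commGamma hg hd (fun x hx => vf_om_of_mem hx) _ (slotProj_mem i q)

/-- `TV y (2d²c)` is a commutator for every vector `y`. -/
lemma TV_mem_commGamma_of_dvd (hg : 2 ≤ g) (hd : Even d) (y : Idx g → ℤ) {k : ℤ}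
    (hk : 2 * (d : ℤ) ^ 2 ∣ k) : TV y k ∈ commGamma g d := by
  let i : Fin g := ⟨0, by omega⟩
  have he (x) (hx : x ∈ slotPerp i) :=
    om_slot_of_mem (y (Sum.inl i)) (y (Sum.inr i)) hx
  rw [eq_add_slotProj i y, TV_add_vec (he _ (slotProj_mem i y))]
  refine mul_mem (mul_mem (TV_mem_commGamma_of_slot hg he hk) ?_)
    (TV_mem_commGamma_of_mem_slotPerp (slotProj_mem i y) hk)
  obtain ⟨c, rfl⟩ := hk
  rw [show 2 * (d : ℤ) ^ 2 * c = (d : ℤ) ^ 2 * (2 * c) by ring, mul_smul]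
  exact ET_mem_commGamma hg hd he (Submodule.smul_mem _ _ (slotProj_mem i y))

end CommutatorMembership

section SlotReduction

variable {g d : ℕ}

lemma conj_mem_commGamma {h : SpZ g} (hh : h ∈ commGamma g d) (A : SpZ g) :
    A * h * A⁻¹ ∈ commGamma g d :=
  (inferInstance : (commGamma g d).Normal).conj_mem h hh A

lemma ET_act_vf_mem_commGamma (hg : 2 ≤ g) (hd : Even d) (i : Fin g) (A : SpZ g) {q : Idx g → ℤ}
    (hq : om (act A (vf i)) q = 0) : ET (act A (vf i)) ((d : ℤ) ^ 2 • q) ∈ commGamma g d := by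
  rw [om_act_left] at hq
  have := conj_mem_commGamma (ET_vf_mem_commGamma hg hd i hq) A
  rwa [conj_ET, map_smul, act_act_inv] at this

lemma ET_act_ve_mem_commGamma (hg : 2 ≤ g) (hd : Even d) (i : Fin g) (A : SpZ g) {q : Idx g → ℤ}
    (hq : om (act A (ve i)) q = 0) : ET (act A (ve i)) ((d : ℤ) ^ 2 • q) ∈ commGamma g d := by
  rw [om_act_left] at hq
  have := conj_mem_commGamma (ET_ve_mem_commGamma hg hd i hq) A
  rwa [conj_ET, map_smul, act_act_inv] at this

/-- Two vectors in the same orbit of `[Γ_g[d], Γ_g[d]]`. -/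
def SameOrbit (g d : ℕ) (v v' : Idx g → ℤ) : Prop := ∃ h ∈ commGamma g d, act h v = v'

lemma SameOrbit.trans {u v w : Idx g → ℤ} (h : SameOrbit g d u v) (h' : SameOrbit g d v w) :
    SameOrbit g d u w := by
  obtain ⟨h, hh, rfl⟩ := h
  obtain ⟨h', hh', rfl⟩ := h'
  exact ⟨h' * h, mul_mem hh' hh, act_mul _ _ _⟩

/-- The vector `a e_i + b f_i + d² w`. -/
def slotVec (d : ℕ) (i : Fin g) (a b : ℤ) (w : Idx g → ℤ) : Idx g → ℤ :=
  a • ve i + b • vf i + (d : ℤ) ^ 2 • w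

lemma om_slotVec_ve {i : Fin g} {a b : ℤ} {w : Idx g → ℤ} (hw : w ∈ slotPerp i) :
    om (slotVec d i a b w) (ve i) = -b := by
  simp only [slotVec, om_add_left, om_smul_left, om_ve_of_mem hw, om_self]
  simp

lemma om_slotVec_vf {i : Fin g} {a b : ℤ} {w : Idx g → ℤ} (hw : w ∈ slotPerp i) :
    om (slotVec d i a b w) (vf i) = a := by
  simp only [slotVec, om_add_left, om_smul_left, om_vf_of_mem hw, om_self]
  simp

lemma om_slotVec_of_mem {i : Fin g} {a b : ℤ} {w u : Idx g → ℤ} (hu : u ∈ slotPerp i) :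
    om (slotVec d i a b w) u = (d : ℤ) ^ 2 * om w u := by
  simp only [slotVec, om_add_left, om_smul_left, ve_om_of_mem hu, vf_om_of_mem hu]
  ring

lemma sameOrbit_slotVec_ET (hg : 2 ≤ g) (hd : Even d) {i : Fin g} (a b : ℤ) {w u : Idx g → ℤ}
    (hw : w ∈ slotPerp i) (hu : u ∈ slotPerp i) :
    SameOrbit g d (slotVec d i a b w)
      (slotVec d i a (b + (d : ℤ) ^ 2 * ((d : ℤ) ^ 2 * om w u)) (w + a • u)) := by
  refine ⟨_, ET_mem_commGamma (e := vf i) hg hd (fun x hx => vf_om_of_mem hx) hu, ?_⟩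
  rw [act_ET (by rw [om_smul_right, vf_om_of_mem hu, mul_zero]), om_smul_right, om_slotVec_vf hw,
    om_slotVec_of_mem hu, slotVec, slotVec]
  module

lemma sameOrbit_slotVec_TV_vf (hg : 2 ≤ g) {i : Fin g} (a b t : ℤ) {w : Idx g → ℤ}
    (hw : w ∈ slotPerp i) :
    SameOrbit g d (slotVec d i a b w) (slotVec d i a (b + 2 * (d : ℤ) ^ 2 * t * a) w) := by
  refine ⟨_, TV_mem_commGamma_of_slot (e := vf i) hg (fun x hx => vf_om_of_mem hx)
    (dvd_mul_right _ t), ?_⟩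
  rw [act_TV, om_slotVec_vf hw, slotVec, slotVec]
  module

lemma sameOrbit_slotVec_TV_ve (hg : 2 ≤ g) {i : Fin g} (a b t : ℤ) {w : Idx g → ℤ}
    (hw : w ∈ slotPerp i) :
    SameOrbit g d (slotVec d i a b w) (slotVec d i (a + t * (2 * (d : ℤ) ^ 2 * b)) b w) := by
  refine ⟨_, TV_mem_commGamma_of_slot (e := ve i) hg (fun x hx => ve_om_of_mem hx)
    (dvd_mul_right _ (-t)), ?_⟩
  rw [act_TV, om_slotVec_ve hw, slotVec, slotVec]
  module

lemma sameOrbit_ve_of_hyperbolic (hg : 2 ≤ g) (hd : Even d) {i : Fin g} (k : ℤ)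
    {y y' : Idx g → ℤ} (hy : y ∈ slotPerp i) (hy' : y' ∈ slotPerp i) (hyy' : om y y' = 1) :
    SameOrbit g d (slotVec d i (1 + (d : ℤ) ^ 2 * k) 0 y) (ve i) := by
  have hu : act (ET (ve i) (k • y')) (vf i) = vf i - k • y' := by
    rw [act_ET (by rw [om_smul_right, ve_om_of_mem hy', mul_zero]), om_smul_right,
      vf_om_of_mem hy', mul_zero, zero_smul]
    simp [sub_eq_add_neg]
  have hyy : om y' y = -1 := by rw [om_swap, hyy']
  have hq : om (vf i - k • y') (-(k • ve i + y)) = 0 := by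
    simp only [sub_eq_add_neg, om_add_left, om_add_right, om_neg_left, om_neg_right, om_smul_left,
      om_smul_right, vf_om_of_mem hy, om_ve_of_mem hy', hyy]
    simp
  have hmem := ET_act_vf_mem_commGamma hg hd i (ET (ve i) (k • y')) (by rwa [hu])
  rw [hu] at hmem
  refine ⟨_, hmem, ?_⟩
  rw [act_ET (by rw [om_smul_right, hq, mul_zero])]
  simp only [slotVec, sub_eq_add_neg, om_add_left, om_add_right, om_neg_right,
    om_smul_left, om_smul_right, vf_om_of_mem hy, om_ve_of_mem hy, ve_om_of_mem hy,
    om_vf_of_mem hy, ve_om_of_mem hy', hyy', om_self, vf_om_of_mem hy']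
  simp only [ve_om, Pi.single_eq_same]
  module

lemma sameOrbit_ve_of_coprime (hg : 2 ≤ g) (hd : Even d) {i : Fin g} {a b c : ℤ}
    (ha : (d : ℤ) ^ 2 ∣ a - 1) (hb : 2 * (d : ℤ) ^ 2 ∣ b) (hac : IsCoprime a c)
    {y y' : Idx g → ℤ} (hy : y ∈ slotPerp i) (hy' : y' ∈ slotPerp i) (hyy' : om y y' = 1) :
    SameOrbit g d (slotVec d i a b (c • y)) (ve i) := by
  obtain ⟨s, r, hsr⟩ := hac
  have hcy := Submodule.smul_mem _ c hy
  refine (sameOrbit_slotVec_ET hg hd a b hcy hy').trans ?_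
  have hb' : 2 * (d : ℤ) ^ 2 ∣ b + (d : ℤ) ^ 2 * ((d : ℤ) ^ 2 * om (c • y) y') := by
    refine dvd_add hb ?_
    rw [mul_comm 2]
    refine mul_dvd_mul_left _ (Dvd.dvd.mul_right ?_ _)
    exact Dvd.dvd.pow (by exact_mod_cast hd.two_dvd) two_ne_zero
  generalize b + (d : ℤ) ^ 2 * ((d : ℤ) ^ 2 * om (c • y) y') = b' at hb'
  have hY : c • y + a • y' ∈ slotPerp i := add_mem hcy (Submodule.smul_mem _ a hy')
  have hY' : r • y' - s • y ∈ slotPerp i :=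
    sub_mem (Submodule.smul_mem _ _ hy') (Submodule.smul_mem _ _ hy)
  have hYY' : om (c • y + a • y') (r • y' - s • y) = 1 := by
    simp only [sub_eq_add_neg, om_add_left, om_add_right, om_neg_right, om_smul_left,
      om_smul_right, om_self, om_swap y y', hyy']
    linear_combination hsr
  generalize c • y + a • y' = Y, r • y' - s • y = Y' at *
  obtain ⟨k, hk⟩ := ha
  obtain ⟨β, rfl⟩ := hb'
  have ha : a = 1 + (d : ℤ) ^ 2 * k := by linear_combination hk
  refine (sameOrbit_slotVec_TV_vf hg a _ (-β) hY).trans ?_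
  refine (sameOrbit_slotVec_ET hg hd a _ hY (Submodule.smul_mem _ (2 * β * k) hY')).trans ?_
  have h0 : 2 * (d : ℤ) ^ 2 * β + 2 * (d : ℤ) ^ 2 * -β * a +
      (d : ℤ) ^ 2 * ((d : ℤ) ^ 2 * om Y ((2 * β * k) • Y')) = 0 := by
    rw [om_smul_right, hYY', ha]
    ring
  rw [h0, ha]
  refine sameOrbit_ve_of_hyperbolic hg hd k
    (add_mem hY (Submodule.smul_mem _ _ (Submodule.smul_mem _ _ hY'))) hY' ?_
  rw [om_add_left, om_smul_left, om_smul_left, hYY', om_self]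
  ring

lemma sameOrbit_ve (hg : 2 ≤ g) (hd : Even d) {i : Fin g} {a b : ℤ}
    (ha : (d : ℤ) ^ 2 ∣ a - 1) (hb : 2 * (d : ℤ) ^ 2 ∣ b) {w z : Idx g → ℤ} (hw : w ∈ slotPerp i)
    (hz : om (slotVec d i a b w) z = 1) : SameOrbit g d (slotVec d i a b w) (ve i) := by
  have h4 : 4 ∣ (d : ℤ) ^ 2 := by
    obtain ⟨b, hb⟩ := hd.two_dvd
    exact ⟨b ^ 2, by rw [hb]; push_cast; ring⟩
  have ha0 : a ≠ 0 := by
    rintro rfl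
    have : (4 : ℤ) ∣ 0 - 1 := h4.trans ha
    omega
  obtain ⟨c, y, y', hy, hy', hyy', rfl⟩ := exists_hyperbolic_of_mem_slotPerp hg hw
  have hgcd : ∃ p q r, a * p + b * q + c * r = 1 := by
    refine ⟨om (ve i) z, om (vf i) z, (d : ℤ) ^ 2 * om y z, ?_⟩
    rw [← hz, slotVec]
    simp only [om_add_left, om_smul_left]
    ring
  clear hz
  wlog hc : c ≠ 0 generalizing c
  · rw [not_not] at hc
    subst hc
    refine (sameOrbit_slotVec_ET hg hd a b hw hy).trans ?_
    rw [zero_smul, zero_add, map_zero, LinearMap.zero_apply, mul_zero, mul_zero, add_zero]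
    refine this a (Submodule.smul_mem _ _ hy) ?_ ha0
    obtain ⟨p, q, r, h⟩ := hgcd
    exact ⟨p, q, 0, by linear_combination h⟩
  obtain ⟨t, ht⟩ := exists_isCoprime_add_mul (a := a) (b := 2 * (d : ℤ) ^ 2 * b) hc (by
    obtain ⟨p, q, r, h⟩ := hgcd
    obtain ⟨P, Q, h'⟩ := isCoprime_two_mul_of_dvd_sub_one h4 ha
    exact ⟨p + b * q * P, Q * q, r, by linear_combination h + b * q * h'⟩)
  refine (sameOrbit_slotVec_TV_ve hg a b t hw).trans
    (sameOrbit_ve_of_coprime hg hd ?_ hb ht hy hy' hyy')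
  rw [add_sub_right_comm]
  exact dvd_add ha (Dvd.dvd.mul_left (Dvd.dvd.mul_right (dvd_mul_left _ _) _) _)

lemma exists_slotProj_eq_smul {i : Fin g} {m : ℤ} {x : Idx g → ℤ}
    (h : ∀ k, k ≠ Sum.inl i → k ≠ Sum.inr i → m ∣ x k) :
    ∃ w ∈ slotPerp i, slotProj i x = m • w := by
  have (k : Idx g) : ∃ c, (k = Sum.inl i ∨ k = Sum.inr i → c = 0) ∧ slotProj i x k = m * c := by
    by_cases hk : k = Sum.inl i
    · exact ⟨0, fun _ => rfl, by rw [hk, (slotProj_mem i x).1, mul_zero]⟩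
    by_cases hk' : k = Sum.inr i
    · exact ⟨0, fun _ => rfl, by rw [hk', (slotProj_mem i x).2, mul_zero]⟩
    obtain ⟨c, hc⟩ := h k hk hk'
    refine ⟨c, by simp [hk, hk'], ?_⟩
    simp [slotProj, hk, hk', hc]
  choose w hw hw' using this
  exact ⟨w, ⟨hw _ (Or.inl rfl), hw _ (Or.inr rfl)⟩, funext hw'⟩

lemma exists_commGamma_mul_fix (hg : 2 ≤ g) (hd : Even d) (hd0 : d ≠ 0) (h2 : Even (d ^ 2))
    (i : Fin g) {A : SpZ g} (hA : A ∈ GammaMod g (d ^ 2) h2) :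
    ∃ h ∈ commGamma g d, act (h * A) (ve i) = ve i ∧ act (h * A) (vf i) = vf i := by
  obtain ⟨h₁, hh₁, he⟩ : SameOrbit g d (act A (ve i)) (ve i) := by
    obtain ⟨w, hw, hw'⟩ := exists_slotProj_eq_smul (i := i) (m := (d : ℤ) ^ 2)
      (x := act A (ve i)) (fun k hk hk' => by
        rw [← act_entry]
        exact_mod_cast Gamma_entry_dvd hA.1 hk)
    have hv : act A (ve i) =
        slotVec d i (act A (ve i) (Sum.inl i)) (act A (ve i) (Sum.inr i)) w := by
      rw [slotVec, ← hw']
      exact eq_add_slotProj i _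
    rw [hv]
    refine sameOrbit_ve (z := act A (vf i)) hg hd ?_ ?_ hw ?_
    · rw [← act_entry]
      simpa using mem_Gamma_iff.mp hA.1 (Sum.inl i) (Sum.inl i)
    · rw [← act_entry]
      exact_mod_cast (hA.2 i).2
    · rw [← hv, om_act_act]
      simp
  rw [← act_mul] at he
  have hB : h₁ * A ∈ GammaMod g (d ^ 2) h2 := mul_mem (commutator_le_GammaMod hd hd0 h2 hh₁) hA
  obtain ⟨w, hw, hw'⟩ := exists_slotProj_eq_smul (i := i) (m := (d : ℤ) ^ 2)
    (x := act (h₁ * A) (vf i)) (fun k hk hk' => by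
      rw [← act_entry]
      exact_mod_cast Gamma_entry_dvd hB.1 hk')
  have h1 : act (h₁ * A) (vf i) (Sum.inr i) = 1 := by
    rw [← ve_om (act (h₁ * A) (vf i)) i]
    nth_rewrite 1 [← he]
    rw [om_act_act]
    simp
  have hx := eq_add_slotProj i (act (h₁ * A) (vf i))
  rw [h1, hw', one_smul] at hx
  have ha : 2 * (d : ℤ) ^ 2 ∣ act (h₁ * A) (vf i) (Sum.inl i) := by
    rw [← act_entry]
    exact_mod_cast (hB.2 i).1
  generalize act (h₁ * A) (vf i) (Sum.inl i) = a at hx ha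
  refine ⟨TV (ve i) a * ET (ve i) ((d : ℤ) ^ 2 • w) * h₁, mul_mem (mul_mem ?_ ?_) hh₁, ?_, ?_⟩
  · exact TV_mem_commGamma_of_slot hg (fun x hx => ve_om_of_mem hx) ha
  · exact ET_mem_commGamma hg hd (fun x hx => ve_om_of_mem hx) hw
  · rw [mul_assoc, act_mul, he, act_mul,
      act_ET (by rw [om_smul_right, ve_om_of_mem hw, mul_zero]), act_TV]
    simp only [om_add_left, om_smul_left, om_smul_right, om_self, ve_om_of_mem hw, om_ve_of_mem hw]
    module
  · rw [mul_assoc, act_mul, hx, act_mul,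
      act_ET (by rw [om_smul_right, ve_om_of_mem hw, mul_zero]), act_TV]
    have hfe : om (vf i) (ve i) = -1 := by simp
    simp only [om_add_left, om_smul_left, om_smul_right, om_self, ve_om_of_mem hw,
      om_ve_of_mem hw, vf_om_of_mem hw, hfe]
    module

end SlotReduction

section PlaneBlocks

variable {g : ℕ}

/-- The matrix `[[a, b], [c, d]]` acting on the `i`-th symplectic plane
(the identity if the determinant is not `1`). -/
def planeSp (i : Fin g) (a b c d : ℤ) : SpZ g :=
  if h : a * d - b * c = 1 then
    mkSp (LinearMap.id + ((a - 1) • om.flip (vf i) + b • om (ve i)).smulRight (ve i) +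
      (c • om.flip (vf i) + (d - 1) • om (ve i)).smulRight (vf i)) fun x y => by
      simp only [LinearMap.add_apply, LinearMap.id_apply, LinearMap.smulRight_apply,
        LinearMap.smul_apply, LinearMap.flip_apply, om_add_left, om_smul_left, om_add_right,
        om_smul_right, smul_eq_mul, om_vf, om_ve, ve_om, vf_om, Pi.add_apply,
        Pi.smul_apply, Pi.single_eq_same, ne_eq, reduceCtorEq, not_false_eq_true,
        Pi.single_eq_of_ne]
      linear_combination (x (Sum.inl i) * y (Sum.inr i) - x (Sum.inr i) * y (Sum.inl i)) * h
  else 1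

variable {i : Fin g} {a b c d : ℤ}

lemma act_planeSp (h : a * d - b * c = 1) (x : Idx g → ℤ) :
    act (planeSp i a b c d) x = x + ((a - 1) * x (Sum.inl i) + b * x (Sum.inr i)) • ve i +
      (c * x (Sum.inl i) + (d - 1) * x (Sum.inr i)) • vf i := by
  rw [planeSp, dif_pos h, act_mkSp]
  simp only [LinearMap.add_apply, LinearMap.id_apply, LinearMap.smulRight_apply,
    LinearMap.smul_apply, LinearMap.flip_apply, smul_eq_mul, om_vf, ve_om]

lemma act_planeSp_of_mem (h : a * d - b * c = 1) {x : Idx g → ℤ} (hx : x ∈ slotPerp i) :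
    act (planeSp i a b c d) x = x := by
  rw [act_planeSp h, hx.1, hx.2]
  simp

lemma act_planeSp_ve (h : a * d - b * c = 1) :
    act (planeSp i a b c d) (ve i) = a • ve i + c • vf i := by
  rw [act_planeSp h]
  simp only [ve, Pi.single_eq_same, ne_eq, reduceCtorEq, not_false_eq_true, Pi.single_eq_of_ne]
  module

lemma act_planeSp_vf (h : a * d - b * c = 1) :
    act (planeSp i a b c d) (vf i) = b • ve i + d • vf i := by
  rw [act_planeSp h]
  simp only [vf, Pi.single_eq_same, ne_eq, reduceCtorEq, not_false_eq_true, Pi.single_eq_of_ne]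
  module

lemma planeSp_mul {a' b' c' d' : ℤ} (h : a * d - b * c = 1) (h' : a' * d' - b' * c' = 1) :
    planeSp i a b c d * planeSp i a' b' c' d' =
      planeSp i (a * a' + b * c') (a * b' + b * d') (c * a' + d * c') (c * b' + d * d') := by
  have h'' : (a * a' + b * c') * (c * b' + d * d') - (a * b' + b * d') * (c * a' + d * c') = 1 := by
    linear_combination (a' * d' - b' * c') * h + h'
  refine act_ext fun x => ?_
  rw [act_mul, act_planeSp h', act_planeSp h, act_planeSp h'']
  simp only [Pi.add_apply, Pi.smul_apply, ve, vf, Pi.single_eq_same, ne_eq, reduceCtorEq,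
    not_false_eq_true, Pi.single_eq_of_ne, smul_eq_mul]
  module

lemma planeSp_upper (k : ℤ) : planeSp i 1 k 0 1 = TV (ve i) (-k) := by
  refine act_ext fun x => ?_
  rw [act_planeSp (by ring), act_TV, om_ve]
  module

lemma planeSp_lower (k : ℤ) : planeSp i 1 0 k 1 = TV (vf i) k := by
  refine act_ext fun x => ?_
  rw [act_planeSp (by ring), act_TV, om_vf]
  module

end PlaneBlocks

section GenusTwo

/-- The matrix `[[a, b], [c, d]]` acting on `⟨e_0, e_1⟩`, and contragrediently on `⟨f_0, f_1⟩`
(the identity if the determinant is not `1`). -/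
def leviSp (a b c d : ℤ) : SpZ 2 :=
  if h : a * d - b * c = 1 then
    mkSp ((om.flip (vf 0)).smulRight (a • ve 0 + c • ve 1) +
      (om.flip (vf 1)).smulRight (b • ve 0 + d • ve 1) +
      (om (ve 0)).smulRight (d • vf 0 - b • vf 1) +
      (om (ve 1)).smulRight (-c • vf 0 + a • vf 1)) fun x y => by
      simp only [LinearMap.add_apply, LinearMap.smulRight_apply, LinearMap.flip_apply, om_vf,
        ve_om]
      simp [om_apply, Fin.sum_univ_two]
      linear_combination (x (Sum.inl 0) * y (Sum.inr 0) - x (Sum.inr 0) * y (Sum.inl 0) +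
        x (Sum.inl 1) * y (Sum.inr 1) - x (Sum.inr 1) * y (Sum.inl 1)) * h
  else 1

variable {a b c d : ℤ}

lemma act_leviSp (h : a * d - b * c = 1) (x : Idx 2 → ℤ) :
    act (leviSp a b c d) x = x (Sum.inl 0) • (a • ve 0 + c • ve 1) +
      x (Sum.inl 1) • (b • ve 0 + d • ve 1) + x (Sum.inr 0) • (d • vf 0 - b • vf 1) +
      x (Sum.inr 1) • (-c • vf 0 + a • vf 1) := by
  rw [leviSp, dif_pos h, act_mkSp]
  simp only [LinearMap.add_apply, LinearMap.smulRight_apply, LinearMap.flip_apply, om_vf, ve_om]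

lemma leviSp_mul {a' b' c' d' : ℤ} (h : a * d - b * c = 1) (h' : a' * d' - b' * c' = 1) :
    leviSp a b c d * leviSp a' b' c' d' =
      leviSp (a * a' + b * c') (a * b' + b * d') (c * a' + d * c') (c * b' + d * d') := by
  have h'' : (a * a' + b * c') * (c * b' + d * d') - (a * b' + b * d') * (c * a' + d * c') = 1 := by
    linear_combination (a' * d' - b' * c') * h + h'
  refine act_ext fun x => ?_
  rw [act_mul, act_leviSp h', act_leviSp h, act_leviSp h'']
  ext k
  rcases k with k | k <;> fin_cases k <;> simp <;> ring

lemma leviSp_upper (k : ℤ) : leviSp 1 k 0 1 = ET (ve 0) (k • vf 1) := by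
  refine act_ext fun x => ?_
  rw [act_leviSp (by ring), act_ET (by simp), om_smul_right, om_ve, om_vf]
  ext k
  rcases k with k | k <;> fin_cases k <;> simp <;> ring

lemma leviSp_lower (k : ℤ) : leviSp 1 0 k 1 = ET (ve 1) (k • vf 0) := by
  refine act_ext fun x => ?_
  rw [act_leviSp (by ring), act_ET (by simp), om_smul_right, om_ve, om_vf]
  ext k
  rcases k with k | k <;> fin_cases k <;> simp
  ring

end GenusTwo

section GenusTwoCentral

variable {d : ℕ}

/-- The projection of `Sp(4; ℤ)` to its quotient by `[Γ_2[d], Γ_2[d]]`. -/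
abbrev qm (d : ℕ) : SpZ 2 →* SpZ 2 ⧸ commGamma 2 d := QuotientGroup.mk' (commGamma 2 d)

lemma qm_eq_one_iff {A : SpZ 2} : qm d A = 1 ↔ A ∈ commGamma 2 d :=
  QuotientGroup.eq_one_iff A

lemma commute_qm_of_conj {A B : SpZ 2} (h : qm d (A * B * A⁻¹) = qm d B) :
    Commute (qm d A) (qm d B) := by
  rw [map_mul, map_mul, map_inv, mul_inv_eq_iff_eq_mul] at h
  exact h

lemma commute_qm_ET {A : SpZ 2} {e u : Idx 2 → ℤ}
    (h : qm d (ET (act A e) (act A u)) = qm d (ET e u)) : Commute (qm d A) (qm d (ET e u)) :=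
  commute_qm_of_conj (by rwa [conj_ET])

lemma commute_qm_TV {A : SpZ 2} {e : Idx 2 → ℤ} {k : ℤ}
    (h : qm d (TV (act A e) k) = qm d (TV e k)) : Commute (qm d A) (qm d (TV e k)) :=
  commute_qm_of_conj (by rwa [conj_TV])

lemma om_eq_zero_of_slotPerp {x y : Idx 2 → ℤ} (hx : x ∈ slotPerp 0) (hy : y ∈ slotPerp 1) :
    om x y = 0 := by
  rw [om_apply, Fin.sum_univ_two, hx.1, hx.2, hy.1, hy.2]
  ring

lemma two_mul_sq_dvd (hd : Even d) : 2 * (d : ℤ) ^ 2 ∣ (d : ℤ) ^ 3 := by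
  obtain ⟨b, hb⟩ := hd.two_dvd
  exact ⟨b, by rw [hb]; push_cast; ring⟩

lemma two_mul_sq_dvd' (hd : Even d) : 2 * (d : ℤ) ^ 2 ∣ ((d : ℤ) ^ 2) ^ 2 :=
  (two_mul_sq_dvd hd).trans ⟨d, by ring⟩

lemma qm_ET_add_smul (hd : Even d) {w z y : Idx 2 → ℤ} (hw : w ∈ slotPerp 0)
    (hz : z ∈ slotPerp 1) (hy : y ∈ slotPerp 1)
    (h : 2 * (d : ℤ) ^ 2 ∣ om ((d : ℤ) ^ 2 • y) z) :
    qm d (ET (z + (d : ℤ) ^ 2 • y) w) = qm d (ET z w) := by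
  have h1 := congrArg (qm d) (ET_add (om_eq_zero_of_slotPerp hw hz)
    (om_eq_zero_of_slotPerp hw ((slotPerp 1).smul_mem ((d : ℤ) ^ 2) hy)))
  rw [map_mul, map_mul, qm_eq_one_iff.mpr (TV_mem_commGamma_of_dvd le_rfl hd w h),
    qm_eq_one_iff.mpr (ET_mem_commGamma le_rfl hd (fun x hx => om_eq_zero_of_slotPerp hw hx) hy),
    mul_one, mul_one] at h1
  rw [ET_comm, h1, ET_comm]

section Plane

variable {a b c e : ℤ} (hd : Even d) (h : a * e - b * c = 1) (ha : (d : ℤ) ^ 2 ∣ a - 1)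
  (he : (d : ℤ) ^ 2 ∣ e - 1) (hb : 2 * (d : ℤ) ^ 2 ∣ b) (hc : 2 * (d : ℤ) ^ 2 ∣ c)

include hd h

include ha hc in
lemma commute_planeSp_ET_ve {w : Idx 2 → ℤ} (hw : w ∈ slotPerp 0) :
    Commute (qm d (planeSp 0 a b c e)) (qm d (ET (ve 0) w)) := by
  refine commute_qm_ET ?_
  rw [act_planeSp_of_mem h hw, act_planeSp_ve h]
  obtain ⟨k, hk⟩ := ha
  obtain ⟨l, rfl⟩ := hc
  have : a • ve 0 + (2 * (d : ℤ) ^ 2 * l) • vf 0 =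
      (ve 0 + (d : ℤ) ^ 2 • (k • ve 0 + (2 * l) • vf 0) : Idx 2 → ℤ) := by
    rw [show a = 1 + (d : ℤ) ^ 2 * k by linear_combination hk]
    module
  rw [this]
  refine qm_ET_add_smul hd hw (by simp [mem_slotPerp]) (by simp [mem_slotPerp]) ⟨-l, ?_⟩
  simp only [om_ve, Pi.add_apply, Pi.smul_apply, smul_eq_mul, Pi.single_eq_same, ne_eq,
    reduceCtorEq, not_false_eq_true, Pi.single_eq_of_ne]
  ring

include he hb in
lemma commute_planeSp_ET_vf {w : Idx 2 → ℤ} (hw : w ∈ slotPerp 0) :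
    Commute (qm d (planeSp 0 a b c e)) (qm d (ET (vf 0) w)) := by
  refine commute_qm_ET ?_
  rw [act_planeSp_of_mem h hw, act_planeSp_vf h]
  obtain ⟨k, hk⟩ := he
  obtain ⟨l, rfl⟩ := hb
  have : (2 * (d : ℤ) ^ 2 * l) • ve 0 + e • vf 0 =
      (vf 0 + (d : ℤ) ^ 2 • ((2 * l) • ve 0 + k • vf 0) : Idx 2 → ℤ) := by
    rw [show e = 1 + (d : ℤ) ^ 2 * k by linear_combination hk]
    module
  rw [this]
  refine qm_ET_add_smul hd hw (by simp [mem_slotPerp]) (by simp [mem_slotPerp]) ⟨l, ?_⟩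
  simp only [om_vf, Pi.add_apply, Pi.smul_apply, smul_eq_mul, Pi.single_eq_same, ne_eq,
    reduceCtorEq, not_false_eq_true, Pi.single_eq_of_ne]
  ring

include he hb in
lemma commute_planeSp_TV_vf (k : ℤ) :
    Commute (qm d (planeSp 0 a b c e)) (qm d (TV (vf 0) k)) := by
  have h1 := congrArg (qm d) (ET_add (e := (vf 0 : Idx 2 → ℤ)) (u := vf 1) (v := k • ve 1)
    (by simp) (by simp))
  rw [map_mul, map_mul, show om (k • ve 1) (vf 1 : Idx 2 → ℤ) = k by rw [om_smul_left, om_vf]; simp,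
    ← eq_inv_mul_iff_mul_eq] at h1
  rw [h1]
  have hf : (vf 1 : Idx 2 → ℤ) ∈ slotPerp 0 := by simp [mem_slotPerp]
  have he' : k • (ve 1 : Idx 2 → ℤ) ∈ slotPerp 0 :=
    Submodule.smul_mem _ _ (by simp [mem_slotPerp])
  exact (commute_planeSp_ET_vf hd h he hb (add_mem hf he')).inv_right.mul_right
    ((commute_planeSp_ET_vf hd h he hb hf).mul_right (commute_planeSp_ET_vf hd h he hb he'))

include ha hc he hb in
lemma qm_planeSp_one : qm d (planeSp 1 a b c e) = qm d (planeSp 0 a b c e) := by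
  have hf : (vf 1 : Idx 2 → ℤ) ∈ slotPerp 0 := by simp [mem_slotPerp]
  have hv : (ve 1 : Idx 2 → ℤ) ∈ slotPerp 0 := by simp [mem_slotPerp]
  have hE := commute_planeSp_ET_ve hd h ha hc hf
  have hF := commute_planeSp_ET_vf hd h he hb hv
  rw [ET_comm] at hF
  have h1 := hE.mul_right (hF.inv_right.mul_right hE)
  simp only [← map_mul, ← map_inv] at h1
  generalize hW : ET (ve 0 : Idx 2 → ℤ) (vf 1) * ((ET (ve 1) (vf 0))⁻¹ * ET (ve 0) (vf 1)) = W
    at h1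
  have h2 : W * planeSp 0 a b c e = planeSp 1 a b c e * W := by
    rw [← hW, ← ET_neg (by simp)]
    refine act_ext fun x => ?_
    have e1 : om (ve 0 : Idx 2 → ℤ) (vf 1) = 0 := by simp
    have e2 : om (ve 1 : Idx 2 → ℤ) (-vf 0) = 0 := by simp
    simp only [act_mul, act_planeSp h, act_ET e1, act_ET e2, om_vf, om_ve, om_neg_right]
    ext k
    rcases k with k | k <;> fin_cases k <;> simp <;> ring
  have h3 := congrArg (qm d) h2
  rw [map_mul, map_mul, ← h1.eq] at h3
  exact (mul_right_cancel h3).symm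

end Plane

end GenusTwoCentral

section CompletionSymbol

variable {Q : Type*} [Group Q]

open Classical in
/-- The value of `F` on a completion of the row `(a, b)` to a unimodular `2 × 2` matrix
whose lower left entry is divisible by `n`. -/
noncomputable def rowSymbol (F : ℤ → ℤ → ℤ → ℤ → Q) (n a b : ℤ) : Q :=
  if h : ∃ p : ℤ × ℤ, n ∣ p.1 ∧ a * p.2 - b * p.1 = 1 then F a b h.choose.1 h.choose.2 else 1

lemma rowSymbol_eq {F : ℤ → ℤ → ℤ → ℤ → Q} {n a b c e : ℤ}
    (hF : ∀ c e k, a * e - b * c = 1 → n ∣ k → F a b (c + k * a) (e + k * b) = F a b c e)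
    (h : a * e - b * c = 1) (hc : n ∣ c) : rowSymbol F n a b = F a b c e := by
  have hex : ∃ p : ℤ × ℤ, n ∣ p.1 ∧ a * p.2 - b * p.1 = 1 := ⟨(c, e), hc, h⟩
  rw [rowSymbol, dif_pos hex]
  obtain ⟨h1, h2⟩ := hex.choose_spec
  generalize hex.choose = p at h1 h2
  obtain ⟨c', e'⟩ := p
  rw [← hF c e (e * c' - c * e') h (dvd_sub (h1.mul_left _) (hc.mul_right _))]
  congr 1
  · linear_combination (-c') * h + c * h2
  · linear_combination (-e') * h + e * h2

lemma exists_completion {n a b : ℤ} (hab : IsCoprime a b) (han : IsCoprime a n) :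
    ∃ c e, a * e - b * c = 1 ∧ n ∣ c := by
  obtain ⟨x, y, h⟩ := han.mul_right hab
  exact ⟨-(n * y), x, by linear_combination h, (dvd_mul_right _ _).neg_right⟩

end CompletionSymbol

section PlaneSymbol

variable {d : ℕ}

/-- The class of `planeSp 0` in the quotient, as a function of the first row. -/
noncomputable def planeSymbol (d : ℕ) (a b : ℤ) : SpZ 2 ⧸ commGamma 2 d :=
  rowSymbol (fun a b c e => qm d (planeSp 0 a b c e)) (2 * (d : ℤ) ^ 2) a b

variable {a b c e : ℤ}

lemma planeSymbol_eq (hd : Even d) (h : a * e - b * c = 1) (hc : 2 * (d : ℤ) ^ 2 ∣ c) :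
    planeSymbol d a b = qm d (planeSp 0 a b c e) := by
  refine rowSymbol_eq (F := fun a b c e => qm d (planeSp 0 a b c e)) (fun c e k h hk => ?_) h hc
  have h1 := planeSp_mul (i := (0 : Fin 2)) (show 1 * 1 - 0 * k = 1 by ring) h
  rw [planeSp_lower, one_mul, zero_mul, one_mul, zero_mul, add_zero, add_zero, one_mul, one_mul,
    add_comm, add_comm _ e] at h1
  rw [← h1, map_mul, qm_eq_one_iff.mpr (TV_mem_commGamma_of_dvd le_rfl hd _ hk), one_mul]

lemma four_dvd_sq (hd : Even d) : (4 : ℤ) ∣ (d : ℤ) ^ 2 := by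
  obtain ⟨b, rfl⟩ := hd.two_dvd
  exact ⟨b ^ 2, by push_cast; ring⟩

lemma dvd_sub_one_of_det {n : ℤ} (h : a * e - b * c = 1) (ha : n ∣ a - 1) (hb : n ∣ b) :
    n ∣ e - 1 := by
  have : e - 1 = b * c - (a - 1) * e := by linear_combination h
  exact this ▸ dvd_sub (hb.mul_right _) (ha.mul_right _)

lemma two_mul_dvd_sub_of_det {m : ℤ} (hm : 2 ∣ m) (h : a * e - b * c = 1) (ha : m ∣ a - 1)
    (hb : 2 * m ∣ b) : 2 * m ∣ e - a := by
  have h2 : (2 : ℤ) ∣ a + 1 := by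
    have := hm.trans ha
    omega
  have : e - a = a * c * b - e * ((a + 1) * (a - 1)) := by linear_combination a * h
  exact this ▸ dvd_sub (hb.mul_left _) ((mul_dvd_mul h2 ha).mul_left _)

lemma exists_planeSymbol_eq (hd : Even d) (ha : (d : ℤ) ^ 2 ∣ a - 1) (hab : IsCoprime a b) :
    ∃ c e, a * e - b * c = 1 ∧ 2 * (d : ℤ) ^ 2 ∣ c ∧
      planeSymbol d a b = qm d (planeSp 0 a b c e) := by
  obtain ⟨c, e, h, hc⟩ :=
    exists_completion hab (isCoprime_two_mul_of_dvd_sub_one (four_dvd_sq hd) ha)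
  exact ⟨c, e, h, hc, planeSymbol_eq hd h hc⟩

lemma planeSymbol_one (hd : Even d) (hb : 2 * (d : ℤ) ^ 2 ∣ b) : planeSymbol d 1 b = 1 := by
  rw [planeSymbol_eq hd (c := 0) (e := 1) (by ring) (dvd_zero _), planeSp_upper, qm_eq_one_iff]
  exact TV_mem_commGamma_of_dvd le_rfl hd _ hb.neg_right

lemma planeSymbol_add_mul_left (hd : Even d) (t : ℤ) (ha : (d : ℤ) ^ 2 ∣ a - 1)
    (hb : 2 * (d : ℤ) ^ 2 ∣ b) (hab : IsCoprime a b) :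
    planeSymbol d (a + t * b) b = planeSymbol d a b := by
  obtain ⟨c, e, h, hc, hs⟩ := exists_planeSymbol_eq hd ha hab
  have he := dvd_sub_one_of_det h ha ((dvd_mul_left _ _).trans hb)
  have hea := two_mul_dvd_sub_of_det ((by norm_num : (2 : ℤ) ∣ 4).trans (four_dvd_sq hd)) h ha hb
  have h1 : (a + b * t) * (e - t * b) - b * (c + e * t - t * (a + b * t)) = 1 := by
    linear_combination h
  have h2 := planeSp_mul (i := (0 : Fin 2)) h (show 1 * 1 - 0 * t = 1 by ring)
  have h3 := planeSp_mul (i := (0 : Fin 2)) (show 1 * 1 - 0 * (-t) = 1 by ring)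
    (show (a + b * t) * e - b * (c + e * t) = 1 by linear_combination h)
  rw [planeSp_lower] at h2 h3
  have hcom := commute_planeSp_TV_vf hd h he hb t
  rw [mul_comm t b, planeSymbol_eq hd h1, hs]
  · rw [show planeSp 0 (a + b * t) b (c + e * t - t * (a + b * t)) (e - t * b) =
        TV (vf 0) (-t) * (planeSp 0 a b c e * TV (vf 0) t) by
      rw [h2]
      simp only [mul_one, mul_zero, zero_add, h3]
      congr 1 <;> ring]
    rw [TV_neg, map_mul, map_mul, map_inv, hcom.eq, inv_mul_cancel_left]
  · rw [show c + e * t - t * (a + b * t) = c + (e - a) * t - b * t ^ 2 by ring]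
    exact dvd_sub (dvd_add hc (hea.mul_right _)) (hb.mul_right _)

lemma planeSymbol_add_mul_right (hd : Even d) (t : ℤ) (ha : (d : ℤ) ^ 2 ∣ a - 1)
    (hab : IsCoprime a b) :
    planeSymbol d a (b + 2 * (d : ℤ) ^ 2 * t * a) = planeSymbol d a b := by
  obtain ⟨c, e, h, hc, hs⟩ := exists_planeSymbol_eq hd ha hab
  have h2 := planeSp_mul (i := (0 : Fin 2)) h
    (show 1 * 1 - (2 * (d : ℤ) ^ 2 * t) * 0 = 1 by ring)
  rw [planeSp_upper] at h2
  rw [hs, planeSymbol_eq hd (c := c) (e := e + 2 * (d : ℤ) ^ 2 * t * c)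
    (by linear_combination h) hc]
  rw [show planeSp 0 a (b + 2 * (d : ℤ) ^ 2 * t * a) c (e + 2 * (d : ℤ) ^ 2 * t * c) =
      planeSp 0 a b c e * TV (ve 0) (-(2 * (d : ℤ) ^ 2 * t)) by
    rw [h2]; congr 1 <;> ring]
  rw [map_mul, qm_eq_one_iff.mpr
    (TV_mem_commGamma_of_dvd le_rfl hd _ (dvd_mul_right _ _).neg_right), mul_one]

end PlaneSymbol

section LeviSymbol

variable {d : ℕ}

lemma qm_TV_add_smul (hd : Even d) {x y : Idx 2 → ℤ} (hxy : om x y = 0) (k : ℤ)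
    (hET : ET x ((d : ℤ) ^ 2 • k • y) ∈ commGamma 2 d) :
    qm d (TV (x + (d : ℤ) ^ 2 • y) k) = qm d (TV x k) := by
  rw [TV_add_vec (by rw [om_smul_right, hxy, mul_zero]), smul_comm k, map_mul, map_mul,
    qm_eq_one_iff.mpr hET, TV_smul, qm_eq_one_iff.mpr (TV_mem_commGamma_of_dvd le_rfl hd y
      ((two_mul_sq_dvd' hd).mul_right k)), mul_one, mul_one]

section Levi

variable {a b c e : ℤ}

lemma act_leviSp_ve_zero (h : a * e - b * c = 1) :
    act (leviSp a b c e) (ve 0) = a • ve 0 + c • ve 1 := by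
  simp [act_leviSp h, ve]

lemma act_leviSp_ve_one (h : a * e - b * c = 1) :
    act (leviSp a b c e) (ve 1) = b • ve 0 + e • ve 1 := by
  simp [act_leviSp h, ve]

lemma act_leviSp_vf_zero (h : a * e - b * c = 1) :
    act (leviSp a b c e) (vf 0) = e • vf 0 - b • vf 1 := by
  simp [act_leviSp h, vf]

variable (hd : Even d) (h : a * e - b * c = 1) (ha : (d : ℤ) ^ 2 ∣ a - 1)
  (he : (d : ℤ) ^ 2 ∣ e - 1) (hb : (d : ℤ) ^ 2 ∣ b) (hc : (d : ℤ) ^ 2 ∣ c)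

include hd h he hb

lemma commute_leviSp_TV_vf (k : ℤ) : Commute (qm d (leviSp a b c e)) (qm d (TV (vf 0) k)) := by
  refine commute_qm_TV ?_
  obtain ⟨l, hl⟩ := he
  obtain ⟨n, rfl⟩ := hb
  rw [act_leviSp_vf_zero h, show e • vf 0 - ((d : ℤ) ^ 2 * n) • vf 1 =
    (vf 0 + (d : ℤ) ^ 2 • (l • vf 0 - n • vf 1) : Idx 2 → ℤ) by
      rw [show e = 1 + (d : ℤ) ^ 2 * l by linear_combination hl]; module]
  have h0 : om (vf 0 : Idx 2 → ℤ) (l • vf 0 - n • vf 1) = 0 := by simp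
  exact qm_TV_add_smul hd h0 k
    (ET_vf_mem_commGamma le_rfl hd 0 (by rw [om_smul_right, h0, mul_zero]))

lemma commute_leviSp_TV_ve (k : ℤ) : Commute (qm d (leviSp a b c e)) (qm d (TV (ve 1) k)) := by
  refine commute_qm_TV ?_
  obtain ⟨l, hl⟩ := he
  obtain ⟨n, rfl⟩ := hb
  rw [act_leviSp_ve_one h, show ((d : ℤ) ^ 2 * n) • ve 0 + e • ve 1 =
    (ve 1 + (d : ℤ) ^ 2 • (n • ve 0 + l • ve 1) : Idx 2 → ℤ) by
      rw [show e = 1 + (d : ℤ) ^ 2 * l by linear_combination hl]; module]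
  have h0 : om (ve 1 : Idx 2 → ℤ) (n • ve 0 + l • ve 1) = 0 := by simp
  exact qm_TV_add_smul hd h0 k
    (ET_ve_mem_commGamma le_rfl hd 1 (by rw [om_smul_right, h0, mul_zero]))

include ha hc

lemma commute_leviSp_ET_ve : Commute (qm d (leviSp a b c e)) (qm d (ET (ve 1) (ve 0))) := by
  refine commute_qm_ET ?_
  obtain ⟨l, hl⟩ := he
  obtain ⟨n, hn⟩ := hb
  obtain ⟨k, hk⟩ := ha
  obtain ⟨p, hp⟩ := hc
  have h0 : act (leviSp a b c e) (ve 0) = ve 0 + (d : ℤ) ^ 2 • (k • ve 0 + p • ve 1) := by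
    rw [act_leviSp_ve_zero h, hp, show a = 1 + (d : ℤ) ^ 2 * k by linear_combination hk]
    module
  have h1 : act (leviSp a b c e) (ve 1) = ve 1 + (d : ℤ) ^ 2 • (n • ve 0 + l • ve 1) := by
    rw [act_leviSp_ve_one h, hn, show e = 1 + (d : ℤ) ^ 2 * l by linear_combination hl]
    module
  have h2 : om (act (leviSp a b c e) (ve 1)) (k • ve 0 + p • ve 1) = 0 := by
    rw [act_leviSp_ve_one h]
    simp only [om_add_left, om_smul_left, ve_om]
    simp
  have h3 : om (ve 0 : Idx 2 → ℤ) (n • ve 0 + l • ve 1) = 0 := by simp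
  rw [h0, ET_add' _ _ _, map_mul,
    qm_eq_one_iff.mpr (ET_act_ve_mem_commGamma le_rfl hd 1 _ h2), mul_one, ET_comm, h1,
    ET_add' _ _ _, map_mul, qm_eq_one_iff.mpr (ET_ve_mem_commGamma le_rfl hd 0 h3), mul_one,
    ET_comm]
  · simp
  · rw [om_smul_right, h3, mul_zero]
  · simp
  · rw [act_leviSp_ve_one h]; simp
  · rw [om_smul_right, h2, mul_zero]
  · simp

lemma commute_leviSp_lower (t : ℤ) :
    Commute (qm d (leviSp a b c e)) (qm d (leviSp 1 0 t 1)) := by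
  have h1 : ET (ve 1 : Idx 2 → ℤ) (ve 0 + t • vf 0) =
      TV (vf 0) t * ET (ve 1) (ve 0) * (TV (vf 0) t)⁻¹ := by
    rw [conj_ET, act_TV, act_TV]
    simp
  have h2 := ET_add (e := (ve 1 : Idx 2 → ℤ)) (u := ve 0) (v := t • vf 0) (by simp) (by simp)
  have hE := commute_leviSp_ET_ve hd h ha he hb hc
  have hF := commute_leviSp_TV_vf hd h he hb t
  have hG := commute_leviSp_TV_ve hd h he hb (om (t • vf 0) (ve 0 : Idx 2 → ℤ))
  rw [← inv_mul_eq_iff_eq_mul, h1] at h2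
  rw [leviSp_lower, ← h2]
  simp only [map_mul, map_inv]
  exact hE.inv_right.mul_right (((hF.mul_right hE).mul_right hF.inv_right).mul_right hG)

end Levi

lemma leviSp_lower_mem (hd : Even d) {k : ℤ} (hk : (d : ℤ) ^ 2 ∣ k) :
    leviSp 1 0 k 1 ∈ commGamma 2 d := by
  obtain ⟨l, rfl⟩ := hk
  rw [leviSp_lower, mul_smul]
  exact ET_ve_mem_commGamma le_rfl hd 1 (by simp)

lemma leviSp_upper_mem (hd : Even d) {k : ℤ} (hk : (d : ℤ) ^ 2 ∣ k) :
    leviSp 1 k 0 1 ∈ commGamma 2 d := by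
  obtain ⟨l, rfl⟩ := hk
  rw [leviSp_upper, mul_smul]
  exact ET_ve_mem_commGamma le_rfl hd 0 (by simp)

/-- The class of `leviSp` in the quotient, as a function of the first row. -/
noncomputable def leviSymbol (d : ℕ) (a b : ℤ) : SpZ 2 ⧸ commGamma 2 d :=
  rowSymbol (fun a b c e => qm d (leviSp a b c e)) ((d : ℤ) ^ 2) a b

variable {a b c e : ℤ}

lemma leviSymbol_eq (hd : Even d) (h : a * e - b * c = 1) (hc : (d : ℤ) ^ 2 ∣ c) :
    leviSymbol d a b = qm d (leviSp a b c e) := by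
  refine rowSymbol_eq (F := fun a b c e => qm d (leviSp a b c e)) (fun c e k h hk => ?_) h hc
  have h1 := leviSp_mul (show 1 * 1 - 0 * k = 1 by ring) h
  rw [one_mul, zero_mul, one_mul, zero_mul, add_zero, add_zero, one_mul, one_mul,
    add_comm, add_comm _ e] at h1
  rw [← h1, map_mul, qm_eq_one_iff.mpr (leviSp_lower_mem hd hk), one_mul]

lemma exists_leviSymbol_eq (hd : Even d) (ha : (d : ℤ) ^ 2 ∣ a - 1) (hab : IsCoprime a b) :
    ∃ c e, a * e - b * c = 1 ∧ (d : ℤ) ^ 2 ∣ c ∧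
      leviSymbol d a b = qm d (leviSp a b c e) := by
  obtain ⟨c, e, h, hc⟩ := exists_completion hab
    (isCoprime_two_mul_of_dvd_sub_one (four_dvd_sq hd) ha).of_mul_right_right
  exact ⟨c, e, h, hc, leviSymbol_eq hd h hc⟩

lemma leviSymbol_add_mul_left (hd : Even d) (t : ℤ) (ha : (d : ℤ) ^ 2 ∣ a - 1)
    (hb : (d : ℤ) ^ 2 ∣ b) (hab : IsCoprime a b) :
    leviSymbol d (a + t * b) b = leviSymbol d a b := by
  obtain ⟨c, e, h, hc, hs⟩ := exists_leviSymbol_eq hd ha hab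
  have he := dvd_sub_one_of_det h ha hb
  have h1 : (a + b * t) * (e - t * b) - b * (c + e * t - t * (a + b * t)) = 1 := by
    linear_combination h
  have h2 := leviSp_mul h (show 1 * 1 - 0 * t = 1 by ring)
  have h3 := leviSp_mul (show 1 * 1 - 0 * (-t) = 1 by ring)
    (show (a + b * t) * e - b * (c + e * t) = 1 by linear_combination h)
  have h4 : leviSp 1 0 (-t) 1 = (leviSp 1 0 t 1)⁻¹ := by
    rw [leviSp_lower, leviSp_lower, neg_smul, ET_neg (by simp)]
  have hcom := commute_leviSp_lower hd h ha he hb hc t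
  rw [mul_comm t b, leviSymbol_eq hd h1, hs]
  · rw [show leviSp (a + b * t) b (c + e * t - t * (a + b * t)) (e - t * b) =
        leviSp 1 0 (-t) 1 * (leviSp a b c e * leviSp 1 0 t 1) by
      rw [h2]
      simp only [mul_one, mul_zero, zero_add, h3]
      congr 1 <;> ring]
    rw [h4, map_mul, map_mul, map_inv, hcom.eq, inv_mul_cancel_left]
  · rw [show c + e * t - t * (a + b * t) = c + ((e - 1) - (a - 1)) * t - b * t ^ 2 by ring]
    exact dvd_sub (dvd_add hc ((dvd_sub he ha).mul_right _)) (hb.mul_right _)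

lemma leviSymbol_add_mul_right (hd : Even d) (t : ℤ) (ha : (d : ℤ) ^ 2 ∣ a - 1)
    (hab : IsCoprime a b) :
    leviSymbol d a (b + (d : ℤ) ^ 2 * t * a) = leviSymbol d a b := by
  obtain ⟨c, e, h, hc, hs⟩ := exists_leviSymbol_eq hd ha hab
  have h2 := leviSp_mul h (show 1 * 1 - ((d : ℤ) ^ 2 * t) * 0 = 1 by ring)
  rw [hs, leviSymbol_eq hd (c := c) (e := e + (d : ℤ) ^ 2 * t * c) (by linear_combination h) hc]
  rw [show leviSp a (b + (d : ℤ) ^ 2 * t * a) c (e + (d : ℤ) ^ 2 * t * c) =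
      leviSp a b c e * leviSp 1 ((d : ℤ) ^ 2 * t) 0 1 by
    rw [h2]; congr 1 <;> ring]
  rw [map_mul, qm_eq_one_iff.mpr (leviSp_upper_mem hd (dvd_mul_right _ _)), mul_one]

end LeviSymbol

section SymbolRelation

variable {d : ℕ}

/-- The symplectic identity behind the relation between the two symbols. -/
lemma leviSp_mul_planeSp_mul_leviSp {a b₁ c₁ d₁ b₂ c₂ d₂ : ℤ} (h₁ : a * d₁ - b₁ * c₁ = 1)
    (h₂ : a * d₂ - b₂ * c₂ = 1)
    (h₃ : a * (d₁ - b₁ * c₁ * d₂ + b₁ * c₁ * d₁ * b₂ * c₂) - b₁ ^ 2 * b₂ * (c₁ ^ 2 * c₂) = 1) :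
    leviSp a b₁ c₁ d₁ * planeSp 1 a b₂ c₂ d₂ * leviSp 1 (-b₁) 0 1 =
      ET (vf 1) (-(c₁ * c₂) • vf 0) * TV (vf 1) (a * c₂) *
        planeSp 0 a (b₁ ^ 2 * b₂) (c₁ ^ 2 * c₂) (d₁ - b₁ * c₁ * d₂ + b₁ * c₁ * d₁ * b₂ * c₂) *
        (ET (ve 1) (-(b₁ * d₁ * b₂) • ve 0 + c₁ • vf 0) * TV (ve 1) (-(d₁ * b₂))) := by
  have e₁ : om (vf 1 : Idx 2 → ℤ) (-(c₁ * c₂) • vf 0) = 0 := by simp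
  have e₂ : om (ve 1 : Idx 2 → ℤ) (-(b₁ * d₁ * b₂) • ve 0 + c₁ • vf 0) = 0 := by simp
  refine act_ext_basis (fun i => ?_) (fun i => ?_) <;> fin_cases i <;>
    simp only [act_mul, act_leviSp h₁, act_leviSp (show 1 * 1 - (-b₁) * 0 = 1 by ring),
      act_planeSp h₂, act_planeSp h₃, act_ET e₁, act_ET e₂, act_TV, om_vf, om_ve, om_add_right,
      om_smul_right] <;>
    ext k <;> rcases k with k | k <;> fin_cases k <;> simp <;> grind

lemma leviSymbol_mul_planeSymbol (hd : Even d) {a b c : ℤ} (ha : (d : ℤ) ^ 2 ∣ a - 1)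
    (hb : (d : ℤ) ^ 2 ∣ b) (hc : 2 * (d : ℤ) ^ 2 ∣ c) (hab : IsCoprime a b) (hac : IsCoprime a c) :
    leviSymbol d a b * planeSymbol d a c = planeSymbol d a (b ^ 2 * c) := by
  obtain ⟨c₁, d₁, h₁, hc₁, hs₁⟩ := exists_leviSymbol_eq hd ha hab
  obtain ⟨c₂, d₂, h₂, hc₂, hs₂⟩ := exists_planeSymbol_eq hd ha hac
  have hc' : (d : ℤ) ^ 2 ∣ c := (dvd_mul_left _ _).trans hc
  have h₃ : a * (d₁ - b * c₁ * d₂ + b * c₁ * d₁ * c * c₂) - b ^ 2 * c * (c₁ ^ 2 * c₂) = 1 := by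
    linear_combination (1 + b * c₁ * c * c₂) * h₁ - b * c₁ * h₂
  have h := congrArg (qm d) (leviSp_mul_planeSp_mul_leviSp h₁ h₂ h₃)
  have hX : ET (ve 1) (-(b * d₁ * c) • ve 0 + c₁ • vf 0) * TV (ve 1) (-(d₁ * c)) ∈
      commGamma 2 d := by
    refine mul_mem ?_ (TV_mem_commGamma_of_dvd le_rfl hd _ (hc.mul_left _).neg_right)
    obtain ⟨k, hk⟩ := hc'
    obtain ⟨l, rfl⟩ := hc₁
    rw [show -(b * d₁ * c) • ve 0 + ((d : ℤ) ^ 2 * l) • vf 0 =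
      ((d : ℤ) ^ 2 • (-(b * d₁ * k) • ve 0 + l • vf 0) : Idx 2 → ℤ) by rw [hk]; module]
    exact ET_ve_mem_commGamma le_rfl hd 1 (by simp)
  have hY : ET (vf 1) (-(c₁ * c₂) • vf 0) * TV (vf 1) (a * c₂) ∈ commGamma 2 d := by
    refine mul_mem ?_ (TV_mem_commGamma_of_dvd le_rfl hd _ (hc₂.mul_left _))
    obtain ⟨l, rfl⟩ := hc₁
    rw [show -((d : ℤ) ^ 2 * l * c₂) • vf 0 =
      ((d : ℤ) ^ 2 • (-(l * c₂)) • vf 0 : Idx 2 → ℤ) by module]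
    exact ET_vf_mem_commGamma le_rfl hd 1 (by simp)
  rw [map_mul, map_mul, map_mul _ _ (_ * _), map_mul, qm_eq_one_iff.mpr hX, qm_eq_one_iff.mpr hY,
    qm_eq_one_iff.mpr (leviSp_upper_mem hd hb.neg_right), mul_one, mul_one, one_mul,
    qm_planeSp_one hd h₂ ha (dvd_sub_one_of_det h₂ ha hc') hc hc₂, ← hs₁, ← hs₂] at h
  rw [h, planeSymbol_eq hd h₃ (hc₂.mul_left _)]

lemma planeSp_mem_commGamma_aux (hd : Even d) (hd0 : d ≠ 0) {a b c e : ℤ} (h : a * e - b * c = 1)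
    (ha : 2 * (d : ℤ) ^ 2 ∣ a - 1) (hb : 2 * (d : ℤ) ^ 2 ∣ b) (hc : 2 * (d : ℤ) ^ 2 ∣ c) :
    planeSp 0 a b c e ∈ commGamma 2 d := by
  rw [← qm_eq_one_iff, ← planeSymbol_eq hd h hc]
  exact lam_eq_one (sig := leviSymbol d) (four_dvd_sq hd) (by positivity)
    (fun b hb => planeSymbol_one hd hb)
    (fun a b t ha hb hab => planeSymbol_add_mul_left hd t ha hb hab)
    (fun a b t ha hb hab => planeSymbol_add_mul_right hd t ha hab)
    (fun a b t ha hb hab => leviSymbol_add_mul_left hd t ha hb hab)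
    (fun a b t ha hb hab => leviSymbol_add_mul_right hd t ha hab)
    (fun a b c ha hb hc hab hac => leviSymbol_mul_planeSymbol hd ha hb hc hab hac) ha hb
    ⟨e, -c, by linear_combination h⟩

lemma planeSp_mem_commGamma (hd : Even d) (hd0 : d ≠ 0) {a b c e : ℤ} (h : a * e - b * c = 1)
    (ha : (d : ℤ) ^ 2 ∣ a - 1) (hb : 2 * (d : ℤ) ^ 2 ∣ b) (hc : 2 * (d : ℤ) ^ 2 ∣ c) :
    planeSp 0 a b c e ∈ commGamma 2 d := by
  by_cases ha' : 2 * (d : ℤ) ^ 2 ∣ a - 1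
  · exact planeSp_mem_commGamma_aux hd hd0 h ha' hb hc
  obtain ⟨k, hk⟩ := ha
  have h1 :
      (1 + (d : ℤ) ^ 2 + (d : ℤ) ^ 4) * (1 - (d : ℤ) ^ 2) - -(d : ℤ) ^ 3 * (d : ℤ) ^ 3 = 1 := by
    ring
  have hN :
      planeSp 0 (1 + (d : ℤ) ^ 2 + (d : ℤ) ^ 4) (-(d : ℤ) ^ 3) ((d : ℤ) ^ 3) (1 - (d : ℤ) ^ 2) ∈
      commGamma 2 d := by
    have h2 := Subgroup.commutator_mem_commutator (TV_mem_Gamma (d := d) (ve (0 : Fin 2)) (-1))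
      (TV_mem_Gamma (d := d) (vf (0 : Fin 2)) 1)
    rw [commutatorElement_def, ← TV_neg, ← TV_neg, show (d : ℤ) * -1 = -d by ring,
      ← planeSp_upper, ← planeSp_upper, ← planeSp_lower, ← planeSp_lower] at h2
    convert h2 using 1
    rw [planeSp_mul (by ring) (by ring), planeSp_mul (by ring) (by ring),
      planeSp_mul (by ring) (by ring)]
    congr 1 <;> ring
  have h3 := two_mul_sq_dvd hd
  rw [← mul_mem_cancel_right hN, planeSp_mul h h1]
  refine planeSp_mem_commGamma_aux hd hd0 ?_ ?_ ?_ ?_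
  · linear_combination h + (a * e - b * c) * h1
  · have hk2 : (2 : ℤ) ∣ k + 1 := by
      have : ¬ (2 : ℤ) ∣ k := fun h => ha' (by rw [hk, mul_comm]; exact mul_dvd_mul_left _ h)
      omega
    have hk3 : 2 * (d : ℤ) ^ 2 ∣ (d : ℤ) ^ 2 * (k + 1) := by
      rw [mul_comm]
      exact mul_dvd_mul_left _ hk2
    rw [show a * (1 + (d : ℤ) ^ 2 + (d : ℤ) ^ 4) + b * (d : ℤ) ^ 3 - 1 =
      (d : ℤ) ^ 2 * (k + 1) * (1 + (d : ℤ) ^ 2) + (d : ℤ) ^ 3 * ((d : ℤ) ^ 3 * k) +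
        b * (d : ℤ) ^ 3 by
      linear_combination (1 + (d : ℤ) ^ 2 + (d : ℤ) ^ 4) * hk]
    exact dvd_add (dvd_add (hk3.mul_right _) (h3.mul_right _)) (hb.mul_right _)
  · exact dvd_add (h3.neg_right.mul_left _) (hb.mul_right _)
  · exact dvd_add (hc.mul_right _) (h3.mul_left _)

end SymbolRelation

section Suspension

variable {g : ℕ}

/-- A vector of rank `2g` extended by zero in a new `0`-th symplectic plane. -/
def suspVec : (Idx g → ℤ) →ₗ[ℤ] (Idx (g + 1) → ℤ) where
  toFun x := Sum.elim (Fin.cons 0 fun i => x (Sum.inl i)) (Fin.cons 0 fun i => x (Sum.inr i))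
  map_add' x y := by
    ext k
    rcases k with k | k <;> refine Fin.cases ?_ (fun _ => ?_) k <;> simp
  map_smul' c x := by
    ext k
    rcases k with k | k <;> refine Fin.cases ?_ (fun _ => ?_) k <;> simp

/-- The restriction of a vector to all symplectic planes but the `0`-th. -/
def desuspVec : (Idx (g + 1) → ℤ) →ₗ[ℤ] (Idx g → ℤ) :=
  LinearMap.funLeft ℤ ℤ (Sum.map Fin.succ Fin.succ)

@[simp] lemma suspVec_inl_zero (x : Idx g → ℤ) : suspVec x (Sum.inl 0) = 0 := rfl

@[simp] lemma suspVec_inr_zero (x : Idx g → ℤ) : suspVec x (Sum.inr 0) = 0 := rfl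

@[simp] lemma suspVec_inl_succ (x : Idx g → ℤ) (i : Fin g) :
    suspVec x (Sum.inl i.succ) = x (Sum.inl i) := rfl

@[simp] lemma suspVec_inr_succ (x : Idx g → ℤ) (i : Fin g) :
    suspVec x (Sum.inr i.succ) = x (Sum.inr i) := rfl

@[simp] lemma desuspVec_inl (x : Idx (g + 1) → ℤ) (i : Fin g) :
    desuspVec x (Sum.inl i) = x (Sum.inl i.succ) := rfl

@[simp] lemma desuspVec_inr (x : Idx (g + 1) → ℤ) (i : Fin g) :
    desuspVec x (Sum.inr i) = x (Sum.inr i.succ) := rfl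

@[simp] lemma desuspVec_suspVec (x : Idx g → ℤ) : desuspVec (suspVec x) = x := by
  ext k
  rcases k with k | k <;> rfl

lemma eq_add_suspVec_desuspVec (x : Idx (g + 1) → ℤ) :
    x = x (Sum.inl 0) • ve 0 + x (Sum.inr 0) • vf 0 + suspVec (desuspVec x) := by
  ext k
  rcases k with k | k <;> refine Fin.cases ?_ (fun _ => ?_) k <;>
    simp [Fin.succ_ne_zero]

lemma suspVec_single (k : Idx g) :
    suspVec (Pi.single k 1) = Pi.single (Sum.map Fin.succ Fin.succ k) 1 := by
  ext j
  rcases j with j | j <;> refine Fin.cases ?_ (fun _ => ?_) j <;> rcases k with k | k <;>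
    simp [Pi.single_apply, (Fin.succ_ne_zero _).symm]

lemma om_succ (x y : Idx (g + 1) → ℤ) :
    om x y = x (Sum.inl 0) * y (Sum.inr 0) - x (Sum.inr 0) * y (Sum.inl 0) +
      om (desuspVec x) (desuspVec y) := by
  rw [om_apply, Fin.sum_univ_succ, om_apply]
  rfl

lemma om_suspVec (x y : Idx g → ℤ) : om (suspVec x) (suspVec y) = om x y := by
  rw [om_succ]
  simp

lemma suspVec_mem_slotPerp (x : Idx g → ℤ) : suspVec x ∈ slotPerp 0 := ⟨rfl, rfl⟩

/-- The endomorphism of the `0`-th plane and its complement underlying `suspSp`. -/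
def suspMap (A : SpZ g) : (Idx (g + 1) → ℤ) →ₗ[ℤ] (Idx (g + 1) → ℤ) :=
  (LinearMap.proj (Sum.inl 0)).smulRight (ve 0) + (LinearMap.proj (Sum.inr 0)).smulRight (vf 0) +
    suspVec ∘ₗ act A ∘ₗ desuspVec

lemma suspMap_apply (A : SpZ g) (x : Idx (g + 1) → ℤ) :
    suspMap A x = x (Sum.inl 0) • ve 0 + x (Sum.inr 0) • vf 0 +
      suspVec (act A (desuspVec x)) := rfl

lemma suspMap_inl (A : SpZ g) (x : Idx (g + 1) → ℤ) :
    suspMap A x (Sum.inl 0) = x (Sum.inl 0) := by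
  simp [suspMap_apply]

lemma suspMap_inr (A : SpZ g) (x : Idx (g + 1) → ℤ) :
    suspMap A x (Sum.inr 0) = x (Sum.inr 0) := by
  simp [suspMap_apply]

lemma desuspVec_suspMap (A : SpZ g) (x : Idx (g + 1) → ℤ) :
    desuspVec (suspMap A x) = act A (desuspVec x) := by
  ext k
  rcases k with k | k <;> simp [suspMap_apply, Fin.succ_ne_zero]

lemma om_suspMap (A : SpZ g) (x y : Idx (g + 1) → ℤ) : om (suspMap A x) (suspMap A y) = om x y := by
  rw [om_succ, om_succ x y, desuspVec_suspMap, desuspVec_suspMap, om_act_act]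
  simp only [suspMap_inl, suspMap_inr]

/-- The embedding `Sp(2g; ℤ) → Sp(2(g + 1); ℤ)` fixing the `0`-th symplectic plane. -/
def suspSp : SpZ g →* SpZ (g + 1) where
  toFun A := mkSp (suspMap A) (om_suspMap A)
  map_one' := act_ext fun x => by
    rw [act_mkSp, suspMap_apply, act_one, act_one, ← eq_add_suspVec_desuspVec]
  map_mul' A B := act_ext fun x => by
    rw [act_mul, act_mkSp, act_mkSp, act_mkSp, suspMap_apply, suspMap_apply A, desuspVec_suspMap,
      suspMap_inl, suspMap_inr, act_mul]

lemma act_suspSp (A : SpZ g) (x : Idx (g + 1) → ℤ) :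
    act (suspSp A) x = x (Sum.inl 0) • ve 0 + x (Sum.inr 0) • vf 0 +
      suspVec (act A (desuspVec x)) :=
  act_mkSp (suspMap A) (om_suspMap A) x

lemma exists_act_eq_of_mem_Gamma {d : ℕ} {A : SpZ g} (hA : A ∈ Gamma g d) (x : Idx g → ℤ) :
    ∃ y, act A x = x + (d : ℤ) • y := by
  obtain ⟨X, hX⟩ := exists_eq_one_add_of_mem_Gamma hA
  refine ⟨X *ᵥ x, ?_⟩
  rw [act_apply, hX, add_mulVec, one_mulVec, smul_mulVec]

lemma suspSp_mem_Gamma {d : ℕ} {A : SpZ g} (hA : A ∈ Gamma g d) : suspSp A ∈ Gamma (g + 1) d := by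
  refine mem_Gamma_of_act fun x => ?_
  obtain ⟨y, hy⟩ := exists_act_eq_of_mem_Gamma hA (desuspVec x)
  refine ⟨suspVec y, ?_⟩
  rw [act_suspSp, hy, map_add, map_smul, ← add_assoc, ← eq_add_suspVec_desuspVec]

lemma suspSp_mem_commGamma {d : ℕ} {A : SpZ g} (hA : A ∈ commGamma g d) :
    suspSp A ∈ commGamma (g + 1) d := by
  have h1 : (commGamma g d).map suspSp ≤ commGamma (g + 1) d := by
    have h2 : (Gamma g d).map suspSp ≤ Gamma (g + 1) d := by
      rintro _ ⟨A, hA, rfl⟩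
      exact suspSp_mem_Gamma hA
    rw [Subgroup.map_commutator]
    exact Subgroup.commutator_mono h2 h2
  exact h1 ⟨A, hA, rfl⟩

lemma act_mem_slotPerp {i : Fin g} {B : SpZ g} (he : act B (ve i) = ve i) (hf : act B (vf i) = vf i)
    {x : Idx g → ℤ} (hx : x ∈ slotPerp i) : act B x ∈ slotPerp i := by
  have h1 := om_act_act B x (ve i)
  have h2 := om_act_act B x (vf i)
  rw [he, om_ve_of_mem hx, om_ve] at h1
  rw [hf, om_vf_of_mem hx, om_vf] at h2
  exact ⟨h2, neg_eq_zero.mp h1⟩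

lemma suspVec_desuspVec_of_mem {x : Idx (g + 1) → ℤ} (hx : x ∈ slotPerp 0) :
    suspVec (desuspVec x) = x := by
  conv_rhs => rw [eq_add_suspVec_desuspVec x, hx.1, hx.2]
  simp

lemma exists_eq_suspSp {B : SpZ (g + 1)} (he : act B (ve 0) = ve 0) (hf : act B (vf 0) = vf 0) :
    ∃ A : SpZ g, B = suspSp A := by
  have hB (x : Idx g → ℤ) : suspVec (desuspVec (act B (suspVec x))) = act B (suspVec x) :=
    suspVec_desuspVec_of_mem (act_mem_slotPerp he hf (suspVec_mem_slotPerp x))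
  refine ⟨mkSp (desuspVec ∘ₗ act B ∘ₗ suspVec) fun x y => ?_, act_ext fun x => ?_⟩
  · simp only [LinearMap.comp_apply]
    rw [← om_suspVec, hB, hB, om_act_act, om_suspVec]
  · rw [act_suspSp, act_mkSp, LinearMap.comp_apply, LinearMap.comp_apply, hB]
    conv_lhs => rw [eq_add_suspVec_desuspVec x, map_add, map_add, map_smul, map_smul, he, hf]

lemma suspSp_apply (A : SpZ g) (i j : Idx g) :
    (suspSp A).1 (Sum.map Fin.succ Fin.succ i) (Sum.map Fin.succ Fin.succ j) = A.1 i j := by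
  rw [act_entry, act_entry, ← suspVec_single, act_suspSp, suspVec_inl_zero, suspVec_inr_zero,
    desuspVec_suspVec, zero_smul, zero_smul, zero_add, zero_add]
  rcases i with i | i <;> rfl

lemma mem_GammaMod_of_suspSp {n : ℕ} (hn : Even n) {A : SpZ g}
    (hA : suspSp A ∈ GammaMod (g + 1) n hn) : A ∈ GammaMod g n hn := by
  refine ⟨mem_Gamma_iff.mpr fun i j => ?_, fun i => ?_⟩
  · have h := mem_Gamma_iff.mp hA.1 (Sum.map Fin.succ Fin.succ i) (Sum.map Fin.succ Fin.succ j)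
    have hinj : Function.Injective (Sum.map (Fin.succ (n := g)) (Fin.succ (n := g))) :=
      Sum.map_injective.mpr ⟨Fin.succ_injective g, Fin.succ_injective g⟩
    rw [suspSp_apply] at h
    simpa only [Matrix.one_apply, hinj.eq_iff] using h
  · have h := hA.2 i.succ
    exact ⟨suspSp_apply A (Sum.inl i) (Sum.inr i) ▸ h.1,
      suspSp_apply A (Sum.inr i) (Sum.inl i) ▸ h.2⟩

end Suspension

section Main

variable {d : ℕ}

lemma eq_planeSp_of_fix {B : SpZ 2} (he : act B (ve 1) = ve 1) (hf : act B (vf 1) = vf 1) :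
    B.1 (Sum.inl 0) (Sum.inl 0) * B.1 (Sum.inr 0) (Sum.inr 0) -
        B.1 (Sum.inl 0) (Sum.inr 0) * B.1 (Sum.inr 0) (Sum.inl 0) = 1 ∧
      B = planeSp 0 (B.1 (Sum.inl 0) (Sum.inl 0)) (B.1 (Sum.inl 0) (Sum.inr 0))
        (B.1 (Sum.inr 0) (Sum.inl 0)) (B.1 (Sum.inr 0) (Sum.inr 0)) := by
  have h1 := act_mem_slotPerp he hf (x := ve 0) (by simp [mem_slotPerp])
  have h2 := act_mem_slotPerp he hf (x := vf 0) (by simp [mem_slotPerp])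
  have h := om_act_act B (ve 0) (vf 0)
  rw [om_apply, Fin.sum_univ_two, h1.1, h1.2, om_vf,
    show (ve 0 : Idx 2 → ℤ) (Sum.inl 0) = 1 from Pi.single_eq_same _ _] at h
  have hdet : act B (ve 0) (Sum.inl 0) * act B (vf 0) (Sum.inr 0) -
      act B (vf 0) (Sum.inl 0) * act B (ve 0) (Sum.inr 0) = 1 := by linear_combination h
  simp only [act_entry]
  refine ⟨hdet, act_ext_basis (Fin.forall_fin_two.mpr ⟨?_, ?_⟩) (Fin.forall_fin_two.mpr ⟨?_, ?_⟩)⟩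
  · rw [act_planeSp_ve hdet]
    ext k
    rcases k with k | k <;> fin_cases k <;> simp [h1.1, h1.2]
  · rw [act_planeSp_of_mem hdet (by simp [mem_slotPerp]), he]
  · rw [act_planeSp_vf hdet]
    ext k
    rcases k with k | k <;> fin_cases k <;> simp [h2.1, h2.2]
  · rw [act_planeSp_of_mem hdet (by simp [mem_slotPerp]), hf]

lemma mem_commGamma_two_of_fix (hd : Even d) (hd0 : d ≠ 0) (h2 : Even (d ^ 2)) {B : SpZ 2}
    (hB : B ∈ GammaMod 2 (d ^ 2) h2) (he : act B (ve 1) = ve 1) (hf : act B (vf 1) = vf 1) :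
    B ∈ commGamma 2 d := by
  obtain ⟨h, hB'⟩ := eq_planeSp_of_fix he hf
  rw [hB']
  refine planeSp_mem_commGamma hd hd0 h ?_ ?_ ?_
  · simpa using mem_Gamma_iff.mp hB.1 (Sum.inl 0) (Sum.inl 0)
  · simpa using (hB.2 0).1
  · simpa using (hB.2 0).2

lemma GammaMod_le_commGamma (hd : Even d) (hd0 : d ≠ 0) (h2 : Even (d ^ 2)) {g : ℕ} (hg : 2 ≤ g) :
    GammaMod g (d ^ 2) h2 ≤ commGamma g d := by
  induction g, hg using Nat.le_induction with
  | base =>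
    intro A hA
    obtain ⟨h, hh, he, hf⟩ := exists_commGamma_mul_fix le_rfl hd hd0 h2 1 hA
    rw [← mul_mem_cancel_left hh]
    exact mem_commGamma_two_of_fix hd hd0 h2
      (mul_mem (commutator_le_GammaMod hd hd0 h2 hh) hA) he hf
  | succ k hk ih =>
    intro A hA
    obtain ⟨h, hh, he, hf⟩ := exists_commGamma_mul_fix (hk.trans k.le_succ) hd hd0 h2 0 hA
    rw [← mul_mem_cancel_left hh]
    have hB := mul_mem (commutator_le_GammaMod hd hd0 h2 hh) hA
    obtain ⟨B, hB'⟩ := exists_eq_suspSp he hf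
    rw [hB'] at hB ⊢
    exact suspSp_mem_commGamma (ih (mem_GammaMod_of_suspSp h2 hB))

end Main

/-- Proposition 2.1 (even case): for `g ≥ 2` and even `d ≥ 2`,
`Γ_g[d², 2d²] = [Γ_g[d], Γ_g[d]]`. -/
theorem GammaMod_sq_eq_commutator_of_even (g d : ℕ) (hg : 2 ≤ g) (hd : 2 ≤ d)
    (hdeven : Even d) :
    GammaMod g (d ^ 2) (by rw [pow_two]; exact hdeven.mul_right d)
      = ⁅Gamma g d, Gamma g d⁆ := by
  have hd0 : d ≠ 0 := by omega
  exact le_antisymm (GammaMod_le_commGamma hdeven hd0 _ hg) (commutator_le_GammaMod hdeven hd0 _)
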